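/- Let T_1(r) = r + Σ_{n≥1} n^n r^{n+1}/(n+1)! (a power series with radius of convergence 1/e). Then for every n ≥ 1 and every r with 0 < r < 1/e, the virial coefficients satisfy |β_{n+1}|/(n+1)! ≤ (C(β)^n/(n+1)) · ((1 + T_1(r))/r)^n; consequently the radius of convergence of the virial series ρ ↦ Σ_{n≥1} (β_n/n!) ρ^n is at least (1/C(β)) · sup_{0<r<1/e} r/(1 + T_1(r)). (In particular the bound holds with r = r̂, the smallest positive solution of r·T_1′(r) − T_1(r) = 1, which is the Groenveld–Ramawadth–Tate criterion.) -/

import Mathlib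

open MeasureTheory ENNReal
open scoped Classical

noncomputable section

/-- Pair weight `w(x,y) = exp(-β φ(x-y))`, with `exp(-(+∞)) = 0`. -/
def pairW {d : ℕ} (β : ℝ) (φ : (Fin d → ℝ) → ℝ≥0∞) (x y : Fin d → ℝ) : ℝ :=
  if φ (x - y) = ∞ then 0 else Real.exp (-(β * (φ (x - y)).toReal))

/-- Truncated weight `ω^T_n`: sum over connected graphs on `{1,…,n}`. -/
def omegaT {S : Type*} (w : S → S → ℝ) (n : ℕ) (x : Fin n → S) : ℝ :=
  ∑ G : SimpleGraph (Fin n),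
    if G.Connected then
      ∏ p ∈ Finset.univ.filter (fun p : Fin n × Fin n => p.1 < p.2 ∧ G.Adj p.1 p.2),
        (w (x p.1) (x p.2) - 1)
    else 0

/-- `φ_n(x; x_1,…,x_n) = Π_i (1 - w(x,x_i)) Π_{i<j} w(x_i,x_j)`. -/
def phiVertex {S : Type*} (w : S → S → ℝ) (n : ℕ) (x : S) (y : Fin n → S) : ℝ :=
  (∏ i, (1 - w x (y i))) *
    ∏ p ∈ Finset.univ.filter (fun p : Fin n × Fin n => p.1 < p.2), w (y p.1) (y p.2)

/-- `g(n) = ∫_{ℝ^{dn}} φ_n(0; x_1,…,x_n) dx`. -/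
def gCoef {d : ℕ} (β : ℝ) (φ : (Fin d → ℝ) → ℝ≥0∞) (n : ℕ) : ℝ≥0∞ :=
  ∫⁻ y : Fin n → Fin d → ℝ, ENNReal.ofReal (phiVertex (pairW β φ) n 0 y)

/-- The vertex sum `Ψ(t) = 1 + Σ_{n≥1} g(n) t^n/n!` (extended to `t ∈ [0,∞]`). -/
def vertexSum {d : ℕ} (β : ℝ) (φ : (Fin d → ℝ) → ℝ≥0∞) (t : ℝ≥0∞) : ℝ≥0∞ :=
  1 + ∑' n : ℕ, gCoef β φ (n + 1) * t ^ (n + 1) / ((n + 1).factorial : ℝ≥0∞)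

/-- The children of vertex `i` in a tree on `{0,…,n}` rooted at `0`. -/
def childrenF {n : ℕ} (τ : SimpleGraph (Fin (n + 1))) (i : Fin (n + 1)) :
    Finset (Fin (n + 1)) :=
  Finset.univ.filter (fun j => τ.Adj i j ∧ τ.dist 0 j = τ.dist 0 i + 1)

/-- `φ_{|t|}(x; (y_j)_{j∈t})`, the vertex weight of `x` with the family of children `t`. -/
def phiFinset {S : Type*} {n : ℕ} (w : S → S → ℝ) (x : S)
    (t : Finset (Fin n)) (y : Fin n → S) : ℝ :=
  (∏ j ∈ t, (1 - w x (y j))) *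
    ∏ p ∈ (t ×ˢ t).filter (fun p => p.1 < p.2), w (y p.1) (y p.2)

/-- `B_n(x_0; x_1,…,x_n)`: sum over trees rooted at `0` of the product of vertex weights. -/
def treeB {S : Type*} (w : S → S → ℝ) (n : ℕ) (x : Fin (n + 1) → S) : ℝ :=
  ∑ τ : SimpleGraph (Fin (n + 1)),
    if τ.IsTree then ∏ i : Fin (n + 1), phiFinset w (x i) (childrenF τ i) x else 0

/-- The tree sum `𝓑(r) = 1 + Σ_{n≥1} (r^n/n!) ∫ B_n(0;x_1,…,x_n) dx`. -/
def treeSum {d : ℕ} (β : ℝ) (φ : (Fin d → ℝ) → ℝ≥0∞) (r : ℝ) : ℝ≥0∞ :=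
  1 + ∑' n : ℕ, ENNReal.ofReal (r ^ (n + 1) / (n + 1).factorial) *
    ∫⁻ y : Fin (n + 1) → Fin d → ℝ,
      ENNReal.ofReal (treeB (pairW β φ) (n + 1) (Fin.cons 0 y))

/-- `bCoef n` represents the infinite-volume cluster coefficient `b_{n+1}`. -/
def bCoef {d : ℕ} (β : ℝ) (φ : (Fin d → ℝ) → ℝ≥0∞) (n : ℕ) : ℝ :=
  ∫ y : Fin n → Fin d → ℝ, omegaT (pairW β φ) (n + 1) (Fin.cons 0 y)

/-- Generalized binomial coefficient `binom(x,k) = x(x-1)⋯(x-k+1)/k!`. -/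
def genBinom (x : ℝ) (k : ℕ) : ℝ :=
  (∏ i ∈ Finset.range k, (x - i)) / k.factorial

/-- Partial exponential Bell polynomial `B_{n,k}(y_1,…,y_{n-k+1})`. -/
def BellPoly (n k : ℕ) (y : ℕ → ℝ) : ℝ :=
  ∑ α ∈ (Fintype.piFinset fun _ : Fin (n - k + 1) => Finset.range (n + 1)) |>.filter
      (fun α : Fin (n - k + 1) → ℕ =>
        (∑ i, α i) = k ∧ (∑ i : Fin (n - k + 1), (i.1 + 1) * α i) = n),
    (n.factorial : ℝ) / (∏ i, ((α i).factorial : ℝ)) *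
      ∏ i : Fin (n - k + 1), (y (i.1 + 1) / ((i.1 + 1).factorial : ℝ)) ^ (α i)

/-- `vCoef n` represents the virial coefficient `β_{n+1}` (so `vCoef 0 = β_1 = 1`). -/
def vCoef {d : ℕ} (β : ℝ) (φ : (Fin d → ℝ) → ℝ≥0∞) (n : ℕ) : ℝ :=
  if n = 0 then 1 else
    ∑ k ∈ Finset.Icc 1 n,
      genBinom (-(n : ℝ)) k * (k.factorial : ℝ) * BellPoly n k (fun j => bCoef β φ j)

/-- `C(β) = ∫ (1 - e^{-βφ(x)}) dx`. -/
def Cbeta {d : ℕ} (β : ℝ) (φ : (Fin d → ℝ) → ℝ≥0∞) : ℝ≥0∞ :=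
  ∫⁻ v : Fin d → ℝ, ENNReal.ofReal (1 - pairW β φ v 0)

/-- `T_1(r) = r + Σ_{n≥1} n^n r^{n+1}/(n+1)!`. -/
def T1 (r : ℝ) : ℝ :=
  r + ∑' n : ℕ, ((n : ℝ) + 1) ^ (n + 1) * r ^ (n + 2) / ((n + 2).factorial : ℝ)

/-- The pairs of distinct elements of `B`. -/
def pairs {ι : Type*} [DecidableEq ι] (B : Finset ι) : Finset (Sym2 ι) :=
  B.sym2.filter fun e => ¬ e.IsDiag

lemma mk_mem_pairs {ι : Type*} [DecidableEq ι] {B : Finset ι} {a b : ι} :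
    s(a, b) ∈ pairs B ↔ a ∈ B ∧ b ∈ B ∧ a ≠ b := by
  simp [pairs, and_assoc]

/-- The Boltzmann factor of the set `B`. -/
def pairWeight {ι : Type*} [DecidableEq ι] (v : Sym2 ι → ℝ) (B : Finset ι) : ℝ :=
  ∏ e ∈ pairs B, v e

lemma pairs_insert {ι : Type*} [DecidableEq ι] {a : ι} {B : Finset ι} (ha : a ∉ B) :
    pairs (insert a B) = B.image (fun b => s(a, b)) ∪ pairs B := by
  ext e
  induction e with | _ x y
  simp only [mk_mem_pairs, Finset.mem_union, Finset.mem_image, Finset.mem_insert, Sym2.eq_iff]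
  constructor
  · rintro ⟨rfl | hx, rfl | hy, h⟩
    · exact absurd rfl h
    · exact Or.inl ⟨y, hy, by simp⟩
    · exact Or.inl ⟨x, hx, by simp⟩
    · exact Or.inr ⟨hx, hy, h⟩
  · rintro (⟨b, hb, ⟨rfl, rfl⟩ | ⟨rfl, rfl⟩⟩ | ⟨hx, hy, h⟩)
    · exact ⟨.inl rfl, .inr hb, fun h => ha (h ▸ hb)⟩
    · exact ⟨.inr hb, .inl rfl, fun h => ha (h ▸ hb)⟩
    · exact ⟨.inr hx, .inr hy, h⟩

lemma pairWeight_empty {ι : Type*} [DecidableEq ι] (v : Sym2 ι → ℝ) :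
    pairWeight v ∅ = 1 := by
  simp [pairWeight, pairs]

lemma pairWeight_insert {ι : Type*} [DecidableEq ι] (v : Sym2 ι → ℝ) {a : ι} {B : Finset ι}
    (ha : a ∉ B) :
    pairWeight v (insert a B) = (∏ b ∈ B, v s(a, b)) * pairWeight v B := by
  rw [pairWeight, pairs_insert ha, Finset.prod_union, Finset.prod_image, pairWeight]
  · intro x _ y _ h
    exact Sym2.congr_right.1 h
  · rw [Finset.disjoint_left]
    intro e he he'
    obtain ⟨b, hb, rfl⟩ := Finset.mem_image.1 he
    exact ha (mk_mem_pairs.1 he').1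

/-- Convolution of set functions. -/
def setConv {ι : Type*} [DecidableEq ι] (F G : Finset ι → ℝ) (B : Finset ι) : ℝ :=
  ∑ C ∈ B.powerset, F C * G (B \ C)

lemma setConv_congr {ι : Type*} [DecidableEq ι] {F F' G G' : Finset ι → ℝ} {B : Finset ι}
    (hF : ∀ C ⊆ B, F C = F' C) (hG : ∀ C ⊆ B, G C = G' C) :
    setConv F G B = setConv F' G' B :=
  Finset.sum_congr rfl fun C hC => by
    rw [hF C (Finset.mem_powerset.1 hC), hG _ Finset.sdiff_subset]

lemma sum_powerset_powerset {ι M : Type*} [DecidableEq ι] [AddCommMonoid M] (B : Finset ι)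
    (F : Finset ι → Finset ι → Finset ι → M) :
    ∑ C ∈ B.powerset, ∑ D ∈ C.powerset, F D (C \ D) (B \ C) =
      ∑ D ∈ B.powerset, ∑ E ∈ (B \ D).powerset, F D E ((B \ D) \ E) := by
  rw [Finset.sum_sigma', Finset.sum_sigma']
  refine Finset.sum_nbij' (fun p => ⟨p.2, p.1 \ p.2⟩) (fun p => ⟨p.1 ∪ p.2, p.1⟩) ?_ ?_ ?_ ?_ ?_
  · rintro ⟨C, D⟩ h
    simp only [Finset.mem_sigma, Finset.mem_powerset] at h ⊢
    exact ⟨h.2.trans h.1, Finset.sdiff_subset_sdiff h.1 subset_rfl⟩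
  · rintro ⟨D, E⟩ h
    simp only [Finset.mem_sigma, Finset.mem_powerset] at h ⊢
    exact ⟨Finset.union_subset h.1 (h.2.trans Finset.sdiff_subset), Finset.subset_union_left⟩
  · rintro ⟨C, D⟩ h
    simp only [Finset.mem_sigma, Finset.mem_powerset] at h
    simp [Finset.union_sdiff_of_subset h.2]
  · rintro ⟨D, E⟩ h
    simp only [Finset.mem_sigma, Finset.mem_powerset] at h
    have : (D ∪ E) \ D = E := by
      rw [Finset.union_sdiff_cancel_left]
      exact (Finset.disjoint_of_subset_left h.2 Finset.sdiff_disjoint).symm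
    simp [this]
  · rintro ⟨C, D⟩ h
    simp only [Finset.mem_sigma, Finset.mem_powerset] at h
    simp only [sdiff_sdiff_left]
    congr 2
    exact (Finset.union_sdiff_of_subset h.2).symm

lemma setConv_comm {ι : Type*} [DecidableEq ι] (F G : Finset ι → ℝ) :
    setConv F G = setConv G F := by
  funext B
  refine Finset.sum_nbij' (fun C => B \ C) (fun C => B \ C) ?_ ?_ ?_ ?_ ?_
  · intro C _; simp
  · intro C _; simp
  · intro C hC; simpa using Finset.mem_powerset.1 hC
  · intro C hC; simpa using Finset.mem_powerset.1 hC
  · intro C hC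
    rw [Finset.sdiff_sdiff_eq_self (Finset.mem_powerset.1 hC), mul_comm]

lemma setConv_assoc {ι : Type*} [DecidableEq ι] (F G H : Finset ι → ℝ) :
    setConv (setConv F G) H = setConv F (setConv G H) := by
  funext B
  simp only [setConv, Finset.sum_mul, Finset.mul_sum]
  rw [sum_powerset_powerset B fun D E R => F D * G E * H R]
  simp only [mul_assoc]

/-- The unit of the convolution of set functions. -/
def setUnit {ι : Type*} (B : Finset ι) : ℝ := if B = ∅ then 1 else 0

lemma setConv_unit {ι : Type*} [DecidableEq ι] (F : Finset ι → ℝ) :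
    setConv F setUnit = F := by
  funext B
  rw [setConv, Finset.sum_eq_single B]
  · simp [setUnit]
  · intro C hC hne
    have : B \ C ≠ ∅ := by
      intro h
      exact hne (Finset.Subset.antisymm (Finset.mem_powerset.1 hC)
        (Finset.sdiff_eq_empty_iff_subset.1 h))
    simp [setUnit, this]
  · simp

lemma setUnit_conv {ι : Type*} [DecidableEq ι] (F : Finset ι → ℝ) :
    setConv setUnit F = F := by
  rw [setConv_comm, setConv_unit]

/-- Multiplying a set function by a multiplicative one commutes with convolution. -/
lemma setConv_twist {ι : Type*} [DecidableEq ι] (t : ι → ℝ) (F G : Finset ι → ℝ) :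
    setConv (fun B => (∏ b ∈ B, t b) * F B) (fun B => (∏ b ∈ B, t b) * G B) =
      fun B => (∏ b ∈ B, t b) * setConv F G B := by
  funext B
  simp only [setConv, Finset.mul_sum]
  refine Finset.sum_congr rfl fun C hC => ?_
  rw [← Finset.prod_sdiff (Finset.mem_powerset.1 hC)]
  ring

/-- The Boltzmann factor of `A ∪ B`, as a function of `B`, at activity `-1`. -/
def signedWeight {ι : Type*} [DecidableEq ι] (v : Sym2 ι → ℝ) (A B : Finset ι) : ℝ :=
  (-1) ^ B.card * pairWeight v (A ∪ B)

/-- The convolution inverse of a set function with value `1` at `∅`. -/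
def setInv {ι : Type*} [DecidableEq ι] (F : Finset ι → ℝ) (B : Finset ι) : ℝ :=
  if B = ∅ then 1 else
    -∑ C ∈ B.ssubsets.attach, setInv F C.1 * F (B \ C.1)
termination_by B.card
decreasing_by exact Finset.card_lt_card (Finset.mem_ssubsets.1 C.2)

lemma setInv_empty {ι : Type*} [DecidableEq ι] (F : Finset ι → ℝ) : setInv F ∅ = 1 := by
  rw [setInv, if_pos rfl]

lemma setInv_of_ne_empty {ι : Type*} [DecidableEq ι] (F : Finset ι → ℝ) {B : Finset ι}
    (hB : B ≠ ∅) : setInv F B = -∑ C ∈ B.ssubsets, setInv F C * F (B \ C) := by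
  rw [setInv, if_neg hB, Finset.sum_attach B.ssubsets fun C => setInv F C * F (B \ C)]

lemma setInv_conv {ι : Type*} [DecidableEq ι] {F : Finset ι → ℝ} (hF : F ∅ = 1) :
    setConv (setInv F) F = setUnit := by
  funext B
  by_cases hB : B = ∅
  · subst hB
    simp [setConv, setUnit, setInv_empty, hF]
  · rw [setConv, ← Finset.insert_erase (Finset.mem_powerset_self B),
      Finset.sum_insert (Finset.notMem_erase _ _)]
    change _ + ∑ C ∈ B.ssubsets, _ = _
    rw [setInv_of_ne_empty F hB]
    simp [setUnit, hB, hF]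

lemma signedWeight_empty {ι : Type*} [DecidableEq ι] (v : Sym2 ι → ℝ) :
    signedWeight v ∅ ∅ = 1 := by
  simp [signedWeight, pairWeight_empty]

/-- The coefficient of the set `B` in the correlation function of the points of `A`, up to the
sign `(-1) ^ |B|`. -/
def corr {ι : Type*} [DecidableEq ι] (v : Sym2 ι → ℝ) (A : Finset ι) : Finset ι → ℝ :=
  setConv (signedWeight v A) (setInv (signedWeight v ∅))

lemma corr_empty_left {ι : Type*} [DecidableEq ι] (v : Sym2 ι → ℝ) :
    corr v ∅ = setUnit := by
  rw [corr, setConv_comm, setInv_conv (signedWeight_empty v)]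

lemma corr_empty_right {ι : Type*} [DecidableEq ι] (v : Sym2 ι → ℝ) (A : Finset ι) :
    corr v A ∅ = pairWeight v A := by
  simp [corr, setConv, signedWeight, setInv_empty]

lemma signedWeight_insert {ι : Type*} [DecidableEq ι] (v : Sym2 ι → ℝ) {a : ι}
    {A B : Finset ι} (hA : a ∉ A) (hB : a ∉ B) (hAB : Disjoint A B) :
    signedWeight v (insert a A) B =
      (∏ i ∈ A, v s(a, i)) * ((∏ b ∈ B, v s(a, b)) * signedWeight v A B) := by
  rw [signedWeight, Finset.insert_union, pairWeight_insert v (by simp [hA, hB]),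
    Finset.prod_union hAB, signedWeight]
  ring

/-- The Kirkwood–Salsburg recursion. -/
lemma corr_insert {ι : Type*} [DecidableEq ι] (v : Sym2 ι → ℝ) {a : ι}
    {A B : Finset ι} (hA : a ∉ A) (hB : a ∉ B) (hAB : Disjoint A B) :
    corr v (insert a A) B = (∏ i ∈ A, v s(a, i)) *
      ∑ D ∈ B.powerset, (∏ b ∈ D, (1 - v s(a, b))) * corr v (A ∪ D) (B \ D) := by
  simp only [corr, setConv, Finset.mul_sum]
  rw [← sum_powerset_powerset B fun D E R => (∏ i ∈ A, v s(a, i)) *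
    ((∏ b ∈ D, (1 - v s(a, b))) * (signedWeight v (A ∪ D) E * setInv (signedWeight v ∅) R))]
  refine Finset.sum_congr rfl fun C hC => ?_
  have hC' := Finset.mem_powerset.1 hC
  rw [signedWeight_insert v hA (fun h => hB (hC' h)) (hAB.mono_right hC')]
  have key : (∏ b ∈ C, v s(a, b)) * signedWeight v A C =
      ∑ D ∈ C.powerset, (∏ b ∈ D, (1 - v s(a, b))) * signedWeight v (A ∪ D) (C \ D) := by
    have h1 : ∏ b ∈ C, v s(a, b) = ∏ b ∈ C, (-(1 - v s(a, b)) + 1) :=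
      Finset.prod_congr rfl fun b _ => by ring
    rw [h1, Finset.prod_add, Finset.sum_mul]
    refine Finset.sum_congr rfl fun D hD => ?_
    have hD' := Finset.mem_powerset.1 hD
    rw [signedWeight, signedWeight, Finset.union_assoc, Finset.union_sdiff_of_subset hD',
      Finset.prod_neg, ← Finset.card_sdiff_add_card_eq_card hD', pow_add]
    have h2 : ((-1 : ℝ) ^ D.card) * (-1) ^ D.card = 1 := by
      rw [← mul_pow]; simp
    simp only [Finset.prod_const_one]
    linear_combination ((∏ b ∈ D, (1 - v s(a, b))) * (-1) ^ (C \ D).card *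
      pairWeight v (A ∪ C)) * h2
  rw [key, Finset.mul_sum, Finset.sum_mul]
  exact Finset.sum_congr rfl fun D _ => by ring

/-- Conditioning on the point `y`. -/
lemma corr_insert_eq_conv {ι : Type*} [DecidableEq ι] (v : Sym2 ι → ℝ) {y : ι}
    {A B : Finset ι} (hA : y ∉ A) (hB : y ∉ B) (hAB : Disjoint A B) :
    corr v (insert y A) B = (∏ i ∈ A, v s(y, i)) *
      ∑ E ∈ B.powerset, corr v {y} E * ((∏ b ∈ B \ E, v s(y, b)) * corr v A (B \ E)) := by
  set t : ι → ℝ := fun b => v s(y, b)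
  set V := signedWeight v ∅
  set I := setInv V
  have hy : ∀ C ⊆ B, corr v {y} C = setConv (fun B => (∏ b ∈ B, t b) * V B) I C := by
    intro C hC
    refine setConv_congr (fun D hD => ?_) fun _ _ => rfl
    have := signedWeight_insert v (Finset.notMem_empty y) (fun h => hB (hC (hD h)))
      (Finset.disjoint_empty_left D)
    simpa using this
  have hl : corr v (insert y A) B = (∏ i ∈ A, v s(y, i)) *
      setConv (fun B => (∏ b ∈ B, t b) * signedWeight v A B) I B := by
    rw [setConv, Finset.mul_sum]
    refine Finset.sum_congr rfl fun D hD => ?_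
    have hD' := Finset.mem_powerset.1 hD
    rw [signedWeight_insert v hA (fun h => hB (hD' h)) (hAB.mono_right hD')]
    ring
  have hu : setConv (fun B => (∏ b ∈ B, t b) * V B) (fun B => (∏ b ∈ B, t b) * I B) =
      setUnit := by
    rw [setConv_twist, setConv_comm V I, setInv_conv (signedWeight_empty v)]
    funext C
    by_cases hC : C = ∅ <;> simp [setUnit, hC]
  rw [hl]
  congr 1
  have hr : ∑ E ∈ B.powerset, corr v {y} E * ((∏ b ∈ B \ E, v s(y, b)) * corr v A (B \ E)) =
      setConv (setConv (fun B => (∏ b ∈ B, t b) * V B) I)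
        (fun B => (∏ b ∈ B, t b) * setConv (signedWeight v A) I B) B :=
    setConv_congr (G := fun C => (∏ b ∈ C, v s(y, b)) * corr v A C) hy fun _ _ => rfl
  rw [hr, ← setConv_twist, setConv_comm _ (fun B => (∏ b ∈ B, t b) * I B), ← setConv_assoc,
    setConv_assoc _ I, setConv_comm I, ← setConv_assoc, hu, setUnit_conv, setConv_comm]

lemma corr_nonneg {ι : Type*} [DecidableEq ι] {v : Sym2 ι → ℝ} (h0 : ∀ e, 0 ≤ v e)
    (h1 : ∀ e, v e ≤ 1) {A B : Finset ι} (hAB : Disjoint A B) : 0 ≤ corr v A B := by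
  induction hn : A.card + B.card generalizing A B with
  | zero =>
    have : A = ∅ := by simpa using (Nat.add_eq_zero_iff.1 hn).1
    subst this
    rw [corr_empty_left, setUnit]
    split_ifs <;> norm_num
  | succ n ih =>
    rcases A.eq_empty_or_nonempty with rfl | ⟨a, ha⟩
    · rw [corr_empty_left, setUnit]
      split_ifs <;> norm_num
    · obtain ⟨A', haA, rfl⟩ : ∃ A', a ∉ A' ∧ insert a A' = A :=
        ⟨A.erase a, Finset.notMem_erase _ _, Finset.insert_erase ha⟩
      obtain ⟨haB, hAB'⟩ := Finset.disjoint_insert_left.1 hAB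
      rw [corr_insert v haA haB hAB']
      rw [Finset.card_insert_of_notMem haA] at hn
      refine mul_nonneg (Finset.prod_nonneg fun _ _ => h0 _) (Finset.sum_nonneg fun D hD => ?_)
      have hD' := Finset.mem_powerset.1 hD
      refine mul_nonneg (Finset.prod_nonneg fun _ _ => sub_nonneg.2 (h1 _)) (ih ?_ ?_)
      · exact Finset.disjoint_union_left.2
          ⟨hAB'.mono_right Finset.sdiff_subset, Finset.disjoint_sdiff⟩
      · rw [Finset.card_union_of_disjoint (hAB'.mono_right hD')]
        have := Finset.card_sdiff_add_card_eq_card hD'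
        omega

lemma pairWeight_map {ι κ : Type*} [DecidableEq ι] [DecidableEq κ] (e : ι ↪ κ)
    {v : Sym2 ι → ℝ} {v' : Sym2 κ → ℝ} {B : Finset ι}
    (h : ∀ i ∈ B, ∀ j ∈ B, v s(i, j) = v' s(e i, e j)) :
    pairWeight v B = pairWeight v' (B.map e) := by
  induction B using Finset.induction_on with
  | empty => simp [pairWeight_empty]
  | insert a B ha ih =>
    rw [Finset.map_insert, pairWeight_insert v ha, pairWeight_insert v' (by simpa using ha),
      ih fun i hi j hj => h i (Finset.mem_insert_of_mem hi) j (Finset.mem_insert_of_mem hj),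
      Finset.prod_map]
    congr 1
    exact Finset.prod_congr rfl fun b hb =>
      h a (Finset.mem_insert_self _ _) b (Finset.mem_insert_of_mem hb)

lemma setInv_map {ι κ : Type*} [DecidableEq ι] [DecidableEq κ] (e : ι ↪ κ)
    {F : Finset ι → ℝ} {F' : Finset κ → ℝ} {B : Finset ι} (h : ∀ C ⊆ B, F C = F' (C.map e)) :
    setInv F B = setInv F' (B.map e) := by
  induction B using Finset.strongInduction with
  | H B ih =>
    by_cases hB : B = ∅
    · subst hB
      simp [setInv_empty]
    rw [setInv_of_ne_empty _ hB, setInv_of_ne_empty _ (by simpa using hB)]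
    congr 1
    refine Finset.sum_bij (fun C _ => C.map e) ?_ ?_ ?_ ?_
    · intro C hC
      simpa using hC
    · intro C _ D _ hCD
      exact Finset.map_injective e hCD
    · intro D hD
      obtain ⟨C, hC, rfl⟩ := Finset.subset_map_iff.1 (Finset.mem_ssubsets.1 hD).subset
      exact ⟨C, by simpa using hD, rfl⟩
    · intro C hC
      have hC' := Finset.mem_ssubsets.1 hC
      rw [ih C hC' fun D hD => h D (hD.trans hC'.subset), h _ Finset.sdiff_subset,
        Finset.map_sdiff]

/-- The value of `corr` only depends on the weights up to relabelling. -/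
lemma corr_map {ι κ : Type*} [DecidableEq ι] [DecidableEq κ] (e : ι ↪ κ) {v : Sym2 ι → ℝ}
    {v' : Sym2 κ → ℝ} {A B : Finset ι}
    (h : ∀ i ∈ A ∪ B, ∀ j ∈ A ∪ B, v s(i, j) = v' s(e i, e j)) :
    corr v A B = corr v' (A.map e) (B.map e) := by
  have hw : ∀ A' ⊆ A, ∀ C ⊆ B, signedWeight v A' C = signedWeight v' (A'.map e) (C.map e) := by
    intro A' hA' C hC
    rw [signedWeight, signedWeight, Finset.card_map, ← Finset.map_union]
    congr 1
    refine pairWeight_map e fun i hi j hj => h i ?_ j ?_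
    · exact Finset.union_subset_union hA' hC hi
    · exact Finset.union_subset_union hA' hC hj
  refine Finset.sum_bij (fun C _ => C.map e) ?_ ?_ ?_ ?_
  · intro C hC
    simpa using hC
  · intro C _ D _ hCD
    exact Finset.map_injective e hCD
  · intro D hD
    obtain ⟨C, hC, rfl⟩ := Finset.subset_map_iff.1 (Finset.mem_powerset.1 hD)
    exact ⟨C, by simpa using hD, rfl⟩
  · intro C hC
    have hC' := Finset.mem_powerset.1 hC
    rw [hw A subset_rfl C hC', ← Finset.map_sdiff]
    congr 1
    refine setInv_map e fun D hD => ?_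
    simpa using hw ∅ (Finset.empty_subset _) D (hD.trans Finset.sdiff_subset)
lemma pairWeight_eq_sum {ι : Type*} [DecidableEq ι] (v : Sym2 ι → ℝ) (B : Finset ι) :
    pairWeight v B = ∑ E ∈ (pairs B).powerset, ∏ e ∈ E, (v e - 1) := by
  have h : pairWeight v B = ∏ e ∈ pairs B, ((v e - 1) + 1) := by simp [pairWeight]
  rw [h, Finset.prod_add]
  simp

/-- The edge sets of the connected graphs on `{c} ∪ B`. -/
def connEdges {ι : Type*} [DecidableEq ι] (c : ι) (B : Finset ι) : Finset (Finset (Sym2 ι)) :=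
  (pairs (insert c B)).powerset.filter fun E : Finset (Sym2 ι) =>
    ∀ b ∈ B, (SimpleGraph.fromEdgeSet (E : Set (Sym2 ι))).Reachable c b

lemma mem_connEdges {ι : Type*} [DecidableEq ι] {c : ι} {B : Finset ι} {E : Finset (Sym2 ι)} :
    E ∈ connEdges c B ↔ E ⊆ pairs (insert c B) ∧
      ∀ b ∈ B, (SimpleGraph.fromEdgeSet (E : Set (Sym2 ι))).Reachable c b := by
  simp [connEdges]

/-- The sum over the connected graphs on `{c} ∪ B`. -/
def connSum {ι : Type*} [DecidableEq ι] (v : Sym2 ι → ℝ) (c : ι) (B : Finset ι) : ℝ :=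
  ∑ E ∈ connEdges c B, ∏ e ∈ E, (v e - 1)

lemma reachable_induction {V : Type*} {G : SimpleGraph V} {c x : V} {p : V → Prop}
    (hx : G.Reachable c x) (hc : p c) (h : ∀ y z, G.Reachable c y → p y → G.Adj y z → p z) :
    p x := by
  rw [SimpleGraph.reachable_iff_reflTransGen] at hx
  induction hx with
  | refl => exact hc
  | tail hy hz ih => exact h _ _ (SimpleGraph.reachable_iff_reflTransGen _ _ |>.2 hy) ih hz

/-- Splitting off the connected component of the vertex `c`. -/
lemma pairWeight_insert_eq_sum_connSum {ι : Type*} [DecidableEq ι] (v : Sym2 ι → ℝ) {c : ι}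
    {B : Finset ι} (hc : c ∉ B) :
    pairWeight v (insert c B) =
      ∑ C ∈ B.powerset, connSum v c C * pairWeight v (B \ C) := by
  have hmem : ∀ {E : Finset (Sym2 ι)} {D : Finset ι} {a b : ι}, E ⊆ pairs D → s(a, b) ∈ E →
      a ∈ D ∧ b ∈ D ∧ a ≠ b := fun hE h => mk_mem_pairs.1 (hE h)
  have hadj : ∀ {E : Finset (Sym2 ι)} {D : Finset ι} {a b : ι}, E ⊆ pairs D →
      ((SimpleGraph.fromEdgeSet (E : Set (Sym2 ι))).Adj a b ↔ s(a, b) ∈ E) := by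
    intro E D a b hE
    rw [SimpleGraph.fromEdgeSet_adj]
    exact ⟨fun h => h.1, fun h => ⟨h, (hmem hE h).2.2⟩⟩
  rw [pairWeight_eq_sum, ← Finset.sum_fiberwise_of_maps_to
    (g := fun E : Finset (Sym2 ι) =>
      B.filter fun b => (SimpleGraph.fromEdgeSet (E : Set (Sym2 ι))).Reachable c b)
    (t := B.powerset) (fun E _ => Finset.mem_powerset.2 (Finset.filter_subset _ _))]
  refine Finset.sum_congr rfl fun C hC => ?_
  have hCB := Finset.mem_powerset.1 hC
  have hdisj : Disjoint (insert c C) (B \ C) := by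
    rw [Finset.disjoint_left]
    intro a ha ha'
    rcases Finset.mem_insert.1 ha with rfl | ha
    · exact hc (Finset.mem_sdiff.1 ha').1
    · exact (Finset.mem_sdiff.1 ha').2 ha
  have hpd : Disjoint (pairs (insert c C)) (pairs (B \ C)) := by
    rw [Finset.disjoint_left]
    intro e
    induction e with | _ a b
    intro h h'
    exact Finset.disjoint_left.1 hdisj (mk_mem_pairs.1 h).1 (mk_mem_pairs.1 h').1
  have hp1 : pairs (insert c C) ⊆ pairs (insert c B) := by
    intro e
    induction e with | _ a b
    simp only [mk_mem_pairs]
    exact fun h => ⟨Finset.insert_subset_insert _ hCB h.1,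
      Finset.insert_subset_insert _ hCB h.2.1, h.2.2⟩
  have hp2 : pairs (B \ C) ⊆ pairs (insert c B) := by
    intro e
    induction e with | _ a b
    simp only [mk_mem_pairs]
    exact fun h => ⟨Finset.mem_insert_of_mem (Finset.mem_sdiff.1 h.1).1,
      Finset.mem_insert_of_mem (Finset.mem_sdiff.1 h.2.1).1, h.2.2⟩
  rw [connSum, pairWeight_eq_sum, Finset.sum_mul_sum, ← Finset.sum_product']
  symm
  refine Finset.sum_nbij' (fun p => p.1 ∪ p.2)
    (fun E => (E ∩ pairs (insert c C), E ∩ pairs (B \ C))) ?_ ?_ ?_ ?_ ?_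
  · rintro ⟨E₁, E₂⟩ h
    simp only [Finset.mem_product, mem_connEdges, Finset.mem_filter, Finset.mem_powerset] at h ⊢
    obtain ⟨⟨h1, hconn⟩, h2⟩ := h
    refine ⟨Finset.union_subset (h1.trans hp1) (h2.trans hp2), ?_⟩
    ext b
    simp only [Finset.mem_filter]
    constructor
    · rintro ⟨hb, hr⟩
      have : b ∈ insert c C := by
        refine reachable_induction hr (Finset.mem_insert_self _ _) fun y z _ hy hyz => ?_
        rw [hadj (Finset.union_subset (h1.trans hp1) (h2.trans hp2)), Finset.mem_union] at hyz
        rcases hyz with hyz | hyz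
        · exact (hmem h1 hyz).2.1
        · exact absurd (hmem h2 hyz).1 (Finset.disjoint_left.1 hdisj hy)
      rcases Finset.mem_insert.1 this with rfl | h
      · exact absurd hb hc
      · exact h
    · intro hb
      refine ⟨hCB hb, (hconn b hb).mono (SimpleGraph.fromEdgeSet_mono ?_)⟩
      exact Finset.coe_subset.2 Finset.subset_union_left
  · intro E h
    simp only [Finset.mem_product, mem_connEdges, Finset.mem_filter, Finset.mem_powerset] at h ⊢
    obtain ⟨hE, rfl⟩ := h
    refine ⟨⟨Finset.inter_subset_right, fun b hb => ?_⟩, Finset.inter_subset_right⟩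
    refine reachable_induction (Finset.mem_filter.1 hb).2 (SimpleGraph.Reachable.refl _)
      fun y z hy hy' hyz => hy'.trans (SimpleGraph.Adj.reachable ?_)
    have hz := hy.trans hyz.reachable
    rw [hadj hE] at hyz
    obtain ⟨hyB, hzB, hne⟩ := hmem hE hyz
    rw [hadj Finset.inter_subset_right, Finset.mem_inter, mk_mem_pairs]
    refine ⟨hyz, ?_, ?_, hne⟩
    · rcases Finset.mem_insert.1 hyB with rfl | hyB
      · exact Finset.mem_insert_self _ _
      · exact Finset.mem_insert_of_mem (Finset.mem_filter.2 ⟨hyB, hy⟩)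
    · rcases Finset.mem_insert.1 hzB with rfl | hzB
      · exact Finset.mem_insert_self _ _
      · exact Finset.mem_insert_of_mem (Finset.mem_filter.2 ⟨hzB, hz⟩)
  · rintro ⟨E₁, E₂⟩ h
    simp only [Finset.mem_product, mem_connEdges, Finset.mem_powerset] at h
    obtain ⟨⟨h1, -⟩, h2⟩ := h
    simp only [Prod.mk.injEq, Finset.union_inter_distrib_right]
    constructor
    · rw [Finset.inter_eq_left.2 h1,
        Finset.disjoint_iff_inter_eq_empty.1 (hpd.symm.mono_left h2), Finset.union_empty]
    · rw [Finset.inter_eq_left.2 h2,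
        Finset.disjoint_iff_inter_eq_empty.1 (hpd.mono_left h1), Finset.empty_union]
  · intro E h
    simp only [Finset.mem_filter, Finset.mem_powerset] at h
    obtain ⟨hE, hEC⟩ := h
    rw [← Finset.inter_union_distrib_left, Finset.inter_eq_left]
    intro e he
    induction e with | _ a b
    obtain ⟨ha, hb, hne⟩ := hmem hE he
    have hab : (SimpleGraph.fromEdgeSet (E : Set (Sym2 ι))).Reachable a b :=
      SimpleGraph.Adj.reachable ((hadj hE).2 he)
    have hin : ∀ x ∈ insert c B,
        ((SimpleGraph.fromEdgeSet (E : Set (Sym2 ι))).Reachable c x → x ∈ insert c C) ∧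
        (¬ (SimpleGraph.fromEdgeSet (E : Set (Sym2 ι))).Reachable c x → x ∈ B \ C) := by
      intro x hx
      rcases Finset.mem_insert.1 hx with rfl | hx
      · exact ⟨fun _ => Finset.mem_insert_self _ _,
          fun h => absurd (SimpleGraph.Reachable.refl _) h⟩
      · subst hEC
        exact ⟨fun h => Finset.mem_insert_of_mem (Finset.mem_filter.2 ⟨hx, h⟩),
          fun h => Finset.mem_sdiff.2 ⟨hx, fun h' => h (Finset.mem_filter.1 h').2⟩⟩
    rw [Finset.mem_union, mk_mem_pairs, mk_mem_pairs]
    by_cases hr : (SimpleGraph.fromEdgeSet (E : Set (Sym2 ι))).Reachable c a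
    · exact .inl ⟨(hin a ha).1 hr, (hin b hb).1 (hr.trans hab), hne⟩
    · exact .inr ⟨(hin a ha).2 hr, (hin b hb).2 fun h => hr (h.trans hab.symm), hne⟩
  · rintro ⟨E₁, E₂⟩ h
    simp only [Finset.mem_product, mem_connEdges, Finset.mem_powerset] at h
    obtain ⟨⟨h1, -⟩, h2⟩ := h
    exact (Finset.prod_union (hpd.mono h1 h2)).symm

lemma corr_singleton_eq_connSum {ι : Type*} [DecidableEq ι] (v : Sym2 ι → ℝ) {c : ι}
    {B : Finset ι} (hc : c ∉ B) : corr v {c} B = (-1) ^ B.card * connSum v c B := by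
  have h : ∀ C ⊆ B, signedWeight v {c} C =
      setConv (fun D => (-1) ^ D.card * connSum v c D) (signedWeight v ∅) C := by
    intro C hC
    rw [signedWeight, ← Finset.insert_eq,
      pairWeight_insert_eq_sum_connSum v (fun h => hc (hC h)), setConv, Finset.mul_sum]
    refine Finset.sum_congr rfl fun D hD => ?_
    rw [← Finset.card_sdiff_add_card_eq_card (Finset.mem_powerset.1 hD), pow_add, signedWeight,
      Finset.empty_union]
    ring
  rw [corr, setConv_congr h fun _ _ => rfl, setConv_assoc, setConv_comm (signedWeight v ∅),
    setInv_conv (signedWeight_empty v), setConv_unit]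

/-- The pair weights of a configuration. -/
def configWeight {ι S : Type*} (w : S → S → ℝ) (hw : ∀ a b, w a b = w b a) (x : ι → S) :
    Sym2 ι → ℝ :=
  Sym2.lift ⟨fun i j => w (x i) (x j), fun _ _ => hw _ _⟩

@[simp]
lemma configWeight_mk {ι S : Type*} (w : S → S → ℝ) (hw : ∀ a b, w a b = w b a) (x : ι → S)
    (i j : ι) : configWeight w hw x s(i, j) = w (x i) (x j) := rfl

lemma omegaT_eq_corr {S : Type*} (w : S → S → ℝ) (hw : ∀ a b, w a b = w b a) (n : ℕ)
    (x : Fin (n + 1) → S) :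
    omegaT w (n + 1) x =
      (-1) ^ n * corr (configWeight w hw x) {0} (Finset.univ.map (Fin.succEmb n)) := by
  have h0 : (0 : Fin (n + 1)) ∉ Finset.univ.map (Fin.succEmb n) := by
    simp [Fin.succ_ne_zero]
  have hins : insert (0 : Fin (n + 1)) (Finset.univ.map (Fin.succEmb n)) =
      Finset.univ := by
    rw [Fin.univ_succ, Finset.cons_eq_insert]
    rfl
  rw [corr_singleton_eq_connSum _ h0, Finset.card_map, Finset.card_univ, Fintype.card_fin,
    ← mul_assoc, ← mul_pow, neg_one_mul, neg_neg, one_pow, one_mul, omegaT, connSum,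
    ← Finset.sum_filter]
  refine Finset.sum_bij' (fun G _ => G.edgeFinset)
    (fun E _ => SimpleGraph.fromEdgeSet (E : Set (Sym2 (Fin (n + 1))))) ?_ ?_ ?_ ?_ ?_
  · intro G hG
    rw [Finset.mem_filter] at hG
    rw [mem_connEdges]
    refine ⟨?_, fun b _ => ?_⟩
    · rw [hins]
      intro e he
      induction e with | _ a b
      simp only [SimpleGraph.mem_edgeFinset, SimpleGraph.mem_edgeSet] at he
      simpa [mk_mem_pairs] using he.ne
    · rw [SimpleGraph.coe_edgeFinset, SimpleGraph.fromEdgeSet_edgeSet]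
      exact hG.2.preconnected 0 b
  · intro E hE
    rw [mem_connEdges] at hE
    rw [Finset.mem_filter]
    refine ⟨Finset.mem_univ _, ?_⟩
    have hr : ∀ b, (SimpleGraph.fromEdgeSet (E : Set (Sym2 (Fin (n + 1))))).Reachable 0 b := by
      intro b
      have hb : b ∈ insert (0 : Fin (n + 1))
          (Finset.univ.map (Fin.succEmb n)) := hins ▸ Finset.mem_univ b
      rcases Finset.mem_insert.1 hb with rfl | hb
      · exact SimpleGraph.Reachable.refl _
      · exact hE.2 b hb
    exact ⟨fun a b => (hr a).symm.trans (hr b)⟩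
  · intro G _
    simp
  · intro E hE
    have hE' := (mem_connEdges.1 hE).1
    ext e
    induction e with | _ a b
    simp only [SimpleGraph.mem_edgeFinset, SimpleGraph.mem_edgeSet, SimpleGraph.fromEdgeSet_adj,
      Finset.mem_coe, and_iff_left_iff_imp]
    exact fun h => (mk_mem_pairs.1 (hE' h)).2.2
  · intro G _
    refine Finset.prod_bij (fun p _ => s(p.1, p.2)) ?_ ?_ ?_ ?_
    · intro p hp
      simpa using (Finset.mem_filter.1 hp).2.2
    · rintro ⟨a, b⟩ hp ⟨a', b'⟩ hp' h
      simp only [Finset.mem_filter] at hp hp'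
      rcases Sym2.eq_iff.1 h with ⟨rfl, rfl⟩ | ⟨rfl, rfl⟩
      · rfl
      · exact absurd hp.2.1 hp'.2.1.not_gt
    · intro e he
      induction e with | _ a b
      simp only [SimpleGraph.mem_edgeFinset, SimpleGraph.mem_edgeSet] at he
      rcases he.ne.lt_or_gt with h | h
      · exact ⟨(a, b), by simp [h, he], rfl⟩
      · exact ⟨(b, a), by simp [h, he.symm], Sym2.eq_swap⟩
    · intro p _
      simp
/-- The number of forests on `m + n` labelled vertices rooted at `m` given vertices. -/
def forestCount (m n : ℕ) : ℕ := if n = 0 then 1 else m * (m + n) ^ (n - 1)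

lemma mul_forestCount (m n : ℕ) : (m + n) * forestCount m n = m * (m + n) ^ n := by
  cases n with
  | zero => simp [forestCount]
  | succ n => simp [forestCount]; ring

lemma sum_choose_mul_pow (c : ℝ) (p : ℕ) :
    ∑ k ∈ Finset.range (p + 2), ((p + 1).choose k : ℝ) * ((c + k) * (c + p + 1) ^ (p + 1 - k)) =
      (c + 1) * (c + p + 1) * (c + p + 2) ^ p := by
  set N := c + p + 1 with hN
  have h1 : ∑ k ∈ Finset.range (p + 2), ((p + 1).choose k : ℝ) * N ^ (p + 1 - k) =
      (1 + N) ^ (p + 1) := by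
    rw [add_pow]
    exact Finset.sum_congr rfl fun k _ => by ring
  have h2 : ∑ k ∈ Finset.range (p + 2), ((p + 1).choose k : ℝ) * k * N ^ (p + 1 - k) =
      (p + 1) * (1 + N) ^ p := by
    rw [Finset.sum_range_succ', add_pow (1 : ℝ) N p, Finset.mul_sum, Nat.cast_zero, mul_zero,
      zero_mul,
      add_zero]
    refine Finset.sum_congr rfl fun k _ => ?_
    have := congrArg (Nat.cast (R := ℝ)) (Nat.add_one_mul_choose_eq p k)
    push_cast at this ⊢
    rw [← this]
    ring
  have h3 : ∑ k ∈ Finset.range (p + 2), ((p + 1).choose k : ℝ) * ((c + k) * N ^ (p + 1 - k)) =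
      c * (1 + N) ^ (p + 1) + (p + 1) * (1 + N) ^ p := by
    rw [← h1, ← h2, Finset.mul_sum, ← Finset.sum_add_distrib]
    exact Finset.sum_congr rfl fun k _ => by ring
  rw [h3]
  have : c + p + 2 = 1 + N := by rw [hN]; ring
  rw [this, hN]
  ring

lemma forestCount_succ (m n : ℕ) :
    ∑ k ∈ Finset.range (n + 1), n.choose k * forestCount (m + k) (n - k) =
      forestCount (m + 1) n := by
  cases n with
  | zero => simp [forestCount]
  | succ p =>
    have hN : (m + (p + 1) : ℕ) ≠ 0 := by omega
    refine Nat.eq_of_mul_eq_mul_left (Nat.pos_of_ne_zero hN) ?_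
    have h : ∀ k ∈ Finset.range (p + 2), (m + (p + 1)) *
        ((p + 1).choose k * forestCount (m + k) (p + 1 - k)) =
        (p + 1).choose k * ((m + k) * (m + (p + 1)) ^ (p + 1 - k)) := by
      intro k hk
      have := mul_forestCount (m + k) (p + 1 - k)
      rw [show m + k + (p + 1 - k) = m + (p + 1) by
        have := Finset.mem_range.1 hk; omega] at this
      rw [← this]; ring
    rw [Finset.mul_sum, Finset.sum_congr rfl h]
    have := sum_choose_mul_pow m p
    have h2 : (m + (p + 1)) * forestCount (m + 1) (p + 1) =
        (m + 1) * (m + p + 1) * (m + p + 2) ^ p := by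
      simp only [forestCount, Nat.add_eq_zero_iff, one_ne_zero, and_false, if_false,
        Nat.add_sub_cancel]
      rw [show m + 1 + (p + 1) = m + p + 2 by ring]
      ring
    rw [h2]
    have h3 := this
    rw [← Nat.cast_inj (R := ℝ)]
    push_cast
    rw [← h3]
    exact Finset.sum_congr rfl fun k _ => by ring

lemma sum_choose_succ_mul_forestCount (p : ℕ) :
    ∑ k ∈ Finset.range (p + 1), (p + 1).choose (k + 1) * forestCount k (p - k) = p ^ p := by
  rcases p.eq_zero_or_pos with rfl | hp
  · simp [forestCount]
  refine Nat.eq_of_mul_eq_mul_left hp ?_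
  have h : ∀ k ∈ Finset.range (p + 1), p * ((p + 1).choose (k + 1) * forestCount k (p - k)) =
      (p + 1).choose (k + 1) * (k * p ^ (p - k)) := by
    intro k hk
    have := mul_forestCount k (p - k)
    rw [show k + (p - k) = p by have := Finset.mem_range.1 hk; omega] at this
    rw [← this]; ring
  rw [Finset.mul_sum, Finset.sum_congr rfl h]
  have := sum_choose_mul_pow (-1) p
  rw [Finset.sum_range_succ'] at this
  rw [← Nat.cast_inj (R := ℝ)]
  simp only [Nat.choose_zero_right, Nat.add_sub_add_right, Nat.cast_add, Nat.cast_one,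
    Nat.cast_zero, add_zero, Nat.sub_zero, neg_add_cancel_comm, neg_add_cancel, zero_mul,
    neg_add_cancel_comm_assoc] at this
  push_cast
  have e : (-1 + (p : ℝ) + 1) = p := by ring
  have h4 : ∑ k ∈ Finset.range (p + 1),
      ((p + 1).choose (k + 1) : ℝ) * ((k : ℝ) * (p : ℝ) ^ (p - k)) =
    (p : ℝ) ^ (p + 1) := by
    linear_combination this
  rw [h4]; ring

/-- A symmetric, translation invariant, repulsive and tempered pair weight. -/
structure IsTemperedWeight {S : Type*} [Add S] [MeasurableSpace S] (μ : Measure S)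
    (w : S → S → ℝ) (K : ℝ≥0∞) : Prop where
  symm : ∀ a b, w a b = w b a
  nonneg : ∀ a b, 0 ≤ w a b
  le_one : ∀ a b, w a b ≤ 1
  measurable : Measurable (Function.uncurry w)
  add_left : ∀ c a b, w (c + a) (c + b) = w a b
  lintegral_le : ∀ a, ∫⁻ b, ENNReal.ofReal (1 - w a b) ∂μ ≤ K

lemma lmarginal_const_mul_of_updateFinset {ι S : Type*} [DecidableEq ι] [MeasurableSpace S]
    {μ : Measure S} {s : Finset ι} {x : ι → S} {k f : (ι → S) → ℝ≥0∞} (hf : Measurable f)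
    (hk : ∀ z, k (Function.updateFinset x s z) = k x) :
    lmarginal (fun _ => μ) s (fun x => k x * f x) x = k x * lmarginal (fun _ => μ) s f x := by
  simp only [lmarginal, hk]
  exact lintegral_const_mul _ (hf.comp measurable_updateFinset)

lemma lmarginal_finset_sum {ι κ S : Type*} [DecidableEq ι] [MeasurableSpace S]
    {μ : Measure S} {s : Finset ι} (x : ι → S) {t : Finset κ} {f : κ → (ι → S) → ℝ≥0∞}
    (hf : ∀ i ∈ t, Measurable (f i)) :
    lmarginal (fun _ => μ) s (fun x => ∑ i ∈ t, f i x) x =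
      ∑ i ∈ t, lmarginal (fun _ => μ) s (f i) x := by
  simp only [lmarginal]
  exact lintegral_finsetSum _ fun i hi => (hf i hi).comp measurable_updateFinset

namespace IsTemperedWeight

variable {S : Type*} [AddCommGroup S] [MeasurableSpace S] {μ : Measure S} {w : S → S → ℝ}
  {K : ℝ≥0∞}

lemma measurable_eval {ι : Type*} (hw : IsTemperedWeight μ w K) (a b : ι) :
    Measurable fun x : ι → S => w (x a) (x b) :=
  Measurable.comp (g := Function.uncurry w) hw.measurable
    ((measurable_pi_apply (X := fun _ : ι => S) a).prodMk (measurable_pi_apply b))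

lemma configWeight_nonneg {ι : Type*} (hw : IsTemperedWeight μ w K) (x : ι → S) (e : Sym2 ι) :
    0 ≤ configWeight w hw.symm x e := by
  induction e with | _ a b
  exact hw.nonneg _ _

lemma configWeight_le_one {ι : Type*} (hw : IsTemperedWeight μ w K) (x : ι → S) (e : Sym2 ι) :
    configWeight w hw.symm x e ≤ 1 := by
  induction e with | _ a b
  exact hw.le_one _ _

lemma measurable_signedWeight {ι : Type*} [DecidableEq ι] (hw : IsTemperedWeight μ w K)
    (A B : Finset ι) : Measurable fun x => signedWeight (configWeight w hw.symm x) A B := by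
  refine (Finset.measurable_prod _ fun e _ => ?_).const_mul _
  induction e with | _ a b
  exact hw.measurable_eval a b

lemma measurable_setInv {ι : Type*} [DecidableEq ι] (hw : IsTemperedWeight μ w K)
    (B : Finset ι) :
    Measurable fun x => setInv (signedWeight (configWeight w hw.symm x) ∅) B := by
  induction B using Finset.strongInduction with
  | H B ih =>
    by_cases hB : B = ∅
    · simp [hB, setInv_empty]
    · simp only [setInv_of_ne_empty _ hB]
      exact (Finset.measurable_sum _ fun C hC =>
        (ih C (Finset.mem_ssubsets.1 hC)).mul (hw.measurable_signedWeight _ _)).neg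

lemma measurable_corr {ι : Type*} [DecidableEq ι] (hw : IsTemperedWeight μ w K)
    (A B : Finset ι) : Measurable fun x => corr (configWeight w hw.symm x) A B :=
  Finset.measurable_sum _ fun _ _ =>
    (hw.measurable_signedWeight _ _).mul (hw.measurable_setInv _)

/-- The correlation coefficient as an extended nonnegative function of the configuration. -/
def corrAt {ι : Type*} [DecidableEq ι] (hw : IsTemperedWeight μ w K) (A B : Finset ι)
    (x : ι → S) : ℝ≥0∞ :=
  ENNReal.ofReal (corr (configWeight w hw.symm x) A B)

lemma measurable_corrAt {ι : Type*} [DecidableEq ι] (hw : IsTemperedWeight μ w K)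
    (A B : Finset ι) : Measurable (hw.corrAt A B) :=
  (hw.measurable_corr A B).ennreal_ofReal

lemma corrAt_congr {ι : Type*} [DecidableEq ι] (hw : IsTemperedWeight μ w K)
    {A B : Finset ι} {x y : ι → S} (h : ∀ i ∈ A ∪ B, x i = y i) :
    hw.corrAt A B x = hw.corrAt A B y := by
  rw [corrAt, corrAt, corr_map (Function.Embedding.refl ι)
    (v' := configWeight w hw.symm y) (fun i hi j hj => ?_)]
  · simp
  · simp [h i hi, h j hj]

/-- The product of the weights `w` between the point `a` and the points of `A`. -/
def boltz {ι : Type*} (_ : IsTemperedWeight μ w K) (a : ι) (A : Finset ι) (x : ι → S) : ℝ≥0∞ :=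
  ∏ i ∈ A, ENNReal.ofReal (w (x a) (x i))

/-- The product of the factors `1 - w` between the point `a` and the points of `A`. -/
def star {ι : Type*} (_ : IsTemperedWeight μ w K) (a : ι) (A : Finset ι) (x : ι → S) : ℝ≥0∞ :=
  ∏ i ∈ A, ENNReal.ofReal (1 - w (x a) (x i))

lemma measurable_boltz {ι : Type*} (hw : IsTemperedWeight μ w K) (a : ι) (A : Finset ι) :
    Measurable (hw.boltz a A) :=
  Finset.measurable_prod _ fun i _ => (hw.measurable_eval a i).ennreal_ofReal

lemma measurable_star {ι : Type*} (hw : IsTemperedWeight μ w K) (a : ι) (A : Finset ι) :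
    Measurable (hw.star a A) :=
  Finset.measurable_prod _ fun i _ => ((hw.measurable_eval a i).const_sub 1).ennreal_ofReal

lemma boltz_le_one {ι : Type*} (hw : IsTemperedWeight μ w K) (a : ι) (A : Finset ι) (x : ι → S) :
    hw.boltz a A x ≤ 1 :=
  Finset.prod_le_one' fun _ _ => ENNReal.ofReal_le_one.2 (hw.le_one _ _)

lemma boltz_congr {ι : Type*} (hw : IsTemperedWeight μ w K) {a : ι} {A : Finset ι} {x y : ι → S}
    (ha : x a = y a) (h : ∀ i ∈ A, x i = y i) : hw.boltz a A x = hw.boltz a A y :=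
  Finset.prod_congr rfl fun i hi => by rw [ha, h i hi]

lemma star_congr {ι : Type*} (hw : IsTemperedWeight μ w K) {a : ι} {A : Finset ι} {x y : ι → S}
    (ha : x a = y a) (h : ∀ i ∈ A, x i = y i) : hw.star a A x = hw.star a A y :=
  Finset.prod_congr rfl fun i hi => by rw [ha, h i hi]

lemma corrAt_insert {ι : Type*} [DecidableEq ι] (hw : IsTemperedWeight μ w K) {a : ι}
    {A B : Finset ι} (hA : a ∉ A) (hB : a ∉ B) (hAB : Disjoint A B) (x : ι → S) :
    hw.corrAt (insert a A) B x = hw.boltz a A x *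
      ∑ D ∈ B.powerset, hw.star a D x * hw.corrAt (A ∪ D) (B \ D) x := by
  have h0 : ∀ D ∈ B.powerset, 0 ≤ corr (configWeight w hw.symm x) (A ∪ D) (B \ D) := by
    intro D hD
    refine corr_nonneg (hw.configWeight_nonneg x) (hw.configWeight_le_one x) ?_
    exact Finset.disjoint_union_left.2
      ⟨hAB.mono_right Finset.sdiff_subset, Finset.disjoint_sdiff⟩
  have h1 : ∀ D : Finset ι, 0 ≤ ∏ b ∈ D, (1 - w (x a) (x b)) := fun D =>
    Finset.prod_nonneg fun b _ => sub_nonneg.2 (hw.le_one _ _)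
  rw [corrAt, corr_insert _ hA hB hAB]
  simp only [configWeight_mk]
  rw [ENNReal.ofReal_mul (Finset.prod_nonneg fun i _ => hw.nonneg _ _),
    ENNReal.ofReal_prod_of_nonneg (fun i _ => hw.nonneg _ _),
    ENNReal.ofReal_sum_of_nonneg (fun D hD => mul_nonneg (h1 D) (h0 D hD))]
  refine congrArg₂ _ rfl (Finset.sum_congr rfl fun D hD => ?_)
  rw [ENNReal.ofReal_mul (h1 D),
    ENNReal.ofReal_prod_of_nonneg (fun b _ => sub_nonneg.2 (hw.le_one _ _))]
  rfl

lemma corrAt_insert_eq_conv {ι : Type*} [DecidableEq ι] (hw : IsTemperedWeight μ w K) {y : ι}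
    {A B : Finset ι} (hA : y ∉ A) (hB : y ∉ B) (hAB : Disjoint A B) (x : ι → S) :
    hw.corrAt (insert y A) B x = hw.boltz y A x *
      ∑ E ∈ B.powerset, hw.corrAt {y} E x * (hw.boltz y (B \ E) x * hw.corrAt A (B \ E) x) := by
  have h0 : ∀ E ∈ B.powerset, 0 ≤ corr (configWeight w hw.symm x) A (B \ E) := fun E hE =>
    corr_nonneg (hw.configWeight_nonneg x) (hw.configWeight_le_one x)
      (hAB.mono_right Finset.sdiff_subset)
  have h1 : ∀ E ∈ B.powerset, 0 ≤ corr (configWeight w hw.symm x) {y} E := fun E hE =>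
    corr_nonneg (hw.configWeight_nonneg x) (hw.configWeight_le_one x)
      (Finset.disjoint_singleton_left.2 fun h => hB (Finset.mem_powerset.1 hE h))
  have h2 : ∀ D : Finset ι, 0 ≤ ∏ b ∈ D, w (x y) (x b) := fun D =>
    Finset.prod_nonneg fun b _ => hw.nonneg _ _
  rw [corrAt, corr_insert_eq_conv _ hA hB hAB]
  simp only [configWeight_mk]
  rw [ENNReal.ofReal_mul (h2 A), ENNReal.ofReal_prod_of_nonneg (fun i _ => hw.nonneg _ _),
    ENNReal.ofReal_sum_of_nonneg
      (fun E hE => mul_nonneg (h1 E hE) (mul_nonneg (h2 _) (h0 E hE)))]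
  refine congrArg₂ _ rfl (Finset.sum_congr rfl fun E hE => ?_)
  rw [ENNReal.ofReal_mul (h1 E hE), ENNReal.ofReal_mul (h2 _),
    ENNReal.ofReal_prod_of_nonneg (fun b _ => hw.nonneg _ _)]
  rfl

lemma corrAt_empty_left {ι : Type*} [DecidableEq ι] (hw : IsTemperedWeight μ w K)
    (B : Finset ι) (x : ι → S) : hw.corrAt ∅ B x = if B = ∅ then 1 else 0 := by
  rw [corrAt, corr_empty_left, setUnit]
  split_ifs <;> simp

variable [SigmaFinite μ]

lemma lmarginal_star_le {ι : Type*} [DecidableEq ι] (hw : IsTemperedWeight μ w K) {a : ι}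
    {D : Finset ι} (ha : a ∉ D) (x : ι → S) :
    lmarginal (fun _ => μ) D (hw.star a D) x ≤ K ^ D.card := by
  induction D using Finset.induction_on generalizing x with
  | empty => simp [star]
  | insert b D hb ih =>
    simp only [Finset.mem_insert, not_or] at ha
    rw [lmarginal_insert _ (hw.measurable_star _ _) hb, Finset.card_insert_of_notMem hb]
    have h : ∀ t : S, lmarginal (fun _ => μ) D (hw.star a (insert b D)) (Function.update x b t) ≤
        ENNReal.ofReal (1 - w (x a) t) * K ^ D.card := by
      intro t
      have e : hw.star a (insert b D) =
          fun x => ENNReal.ofReal (1 - w (x a) (x b)) * hw.star a D x := by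
        funext x; simp [star, Finset.prod_insert hb]
      rw [e, lmarginal_const_mul_of_updateFinset (hw.measurable_star a D)]
      · rw [Function.update_of_ne ha.1, Function.update_self]
        gcongr
        exact ih ha.2 _
      · intro z
        simp [Function.updateFinset, ha.2, hb]
    refine (lintegral_mono h).trans ?_
    rw [lintegral_mul_const, pow_succ, mul_comm]
    · gcongr
      exact hw.lintegral_le _
    · exact ((hw.measurable.comp measurable_prodMk_left).const_sub 1).ennreal_ofReal

lemma lmarginal_star_mul_le {ι : Type*} [DecidableEq ι] (hw : IsTemperedWeight μ w K) {a : ι}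
    {D B : Finset ι} (ha : a ∉ B) (hD : D ⊆ B) {f : (ι → S) → ℝ≥0∞} (hf : Measurable f)
    {c : ℝ≥0∞} (h : ∀ x, lmarginal (fun _ => μ) (B \ D) f x ≤ c) (x : ι → S) :
    lmarginal (fun _ => μ) B (fun x => hw.star a D x * f x) x ≤ K ^ D.card * c := by
  have hB : B = D ∪ (B \ D) := (Finset.union_sdiff_of_subset hD).symm
  conv_lhs => rw [hB]
  rw [lmarginal_union (fun _ => μ) (fun x => hw.star a D x * f x)
    ((hw.measurable_star a D).mul hf) Finset.disjoint_sdiff]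
  have h1 : lmarginal (fun _ => μ) (B \ D) (fun x => hw.star a D x * f x) ≤
      fun x => c * hw.star a D x := by
    intro x
    beta_reduce
    rw [lmarginal_const_mul_of_updateFinset hf, mul_comm]
    · gcongr
      exact h x
    · intro z
      refine hw.star_congr ?_ fun i hi => ?_
      · simp [Function.updateFinset, ha]
      · simp [Function.updateFinset, hi]
  refine (lmarginal_mono h1 x).trans ?_
  rw [lmarginal_const_mul_of_updateFinset (k := fun _ => c) (hw.measurable_star a D)
    fun _ => rfl, mul_comm]
  gcongr
  exact hw.lmarginal_star_le (fun h => ha (hD h)) x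

lemma lmarginal_corrAt_le {ι : Type*} [DecidableEq ι] (hw : IsTemperedWeight μ w K)
    {A B : Finset ι} (hAB : Disjoint A B) (x : ι → S) :
    lmarginal (fun _ => μ) B (hw.corrAt A B) x ≤ forestCount A.card B.card * K ^ B.card := by
  induction hn : A.card + B.card generalizing A B x with
  | zero =>
    obtain ⟨hA, hB⟩ := Nat.add_eq_zero_iff.1 hn
    rw [Finset.card_eq_zero] at hA hB
    subst hA hB
    simp [corrAt_empty_left, forestCount]
  | succ n ih =>
    rcases A.eq_empty_or_nonempty with rfl | ⟨a, haA⟩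
    · have : B ≠ ∅ := by rintro rfl; simp at hn
      simp [funext (hw.corrAt_empty_left B), this, lmarginal]
    obtain ⟨A, ha, rfl⟩ : ∃ A', a ∉ A' ∧ insert a A' = A :=
      ⟨A.erase a, Finset.notMem_erase a A, Finset.insert_erase haA⟩
    rw [Finset.disjoint_insert_left] at hAB
    have hle : hw.corrAt (insert a A) B ≤
        fun x => ∑ D ∈ B.powerset, hw.star a D x * hw.corrAt (A ∪ D) (B \ D) x := by
      intro x
      rw [hw.corrAt_insert ha hAB.1 hAB.2]
      exact mul_le_of_le_one_left' (hw.boltz_le_one a A x)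
    refine (lmarginal_mono hle x).trans ?_
    rw [lmarginal_finset_sum x
      (f := fun D x => hw.star a D x * hw.corrAt (A ∪ D) (B \ D) x) fun D _ =>
      (hw.measurable_star a D).mul (hw.measurable_corrAt _ _), Finset.card_insert_of_notMem ha,
      ← forestCount_succ]
    have hterm : ∀ D ∈ B.powerset, lmarginal (fun _ => μ) B
        (fun x => hw.star a D x * hw.corrAt (A ∪ D) (B \ D) x) x ≤
        (forestCount (A.card + D.card) (B.card - D.card) : ℝ≥0∞) * K ^ B.card := by
      intro D hD
      rw [Finset.mem_powerset] at hD
      have hAD : Disjoint A D := hAB.2.mono_right hD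
      have hc : (B \ D).card = B.card - D.card := Finset.card_sdiff_of_subset hD
      have hcard : D.card ≤ B.card := Finset.card_le_card hD
      refine (hw.lmarginal_star_mul_le hAB.1 hD (hw.measurable_corrAt _ _) (fun x => ih
        (Finset.disjoint_union_left.2 ⟨hAB.2.mono_right Finset.sdiff_subset,
          Finset.disjoint_sdiff⟩) x ?_) x).trans ?_
      · rw [Finset.card_union_of_disjoint hAD, hc]
        rw [Finset.card_insert_of_notMem ha] at hn
        omega
      · rw [Finset.card_union_of_disjoint hAD, hc, mul_left_comm, ← pow_add,
          Nat.add_sub_cancel' hcard]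
    refine (Finset.sum_le_sum hterm).trans_eq ?_
    rw [← Finset.sum_mul,
      Finset.sum_powerset_apply_card fun k => (forestCount (A.card + k) (B.card - k) : ℝ≥0∞)]
    push_cast
    simp only [nsmul_eq_mul]

end IsTemperedWeight

namespace IsTemperedWeight

variable {S : Type*} [AddCommGroup S] [MeasurableSpace S] {μ : Measure S} {w : S → S → ℝ}
  {K : ℝ≥0∞}

/-- The integral of the correlation coefficient of a point with `n` further points. -/
def rootIntegral (hw : IsTemperedWeight μ w K) (n : ℕ) : ℝ≥0∞ :=
  ∫⁻ z : Fin n → S, hw.corrAt {0} (Finset.univ.map (Fin.succEmb n))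
    (Fin.cons 0 z : Fin (n + 1) → S) ∂Measure.pi fun _ => μ

/-- The contribution to `corrAt {0} (D ∪ H)` in which the neighbours of `0` are the points of `D`
and no cluster is attached to the smallest element of `D`. -/
def kernTerm (hw : IsTemperedWeight μ w K) (D H : Finset ℕ) (x : ℕ → S) : ℝ≥0∞ :=
  hw.star 0 D x * hw.boltz (sInf (D : Set ℕ)) (D.erase (sInf (D : Set ℕ))) x *
    (hw.boltz (sInf (D : Set ℕ)) H x * hw.corrAt (D.erase (sInf (D : Set ℕ))) H x)

/-- The integral over the points of `F` of the sum of the terms `kernTerm D (F \ D)`. -/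
def kernIntegral (hw : IsTemperedWeight μ w K) (F : Finset ℕ) : ℝ≥0∞ :=
  ∑ D ∈ F.powerset with D.Nonempty, lmarginal (fun _ => μ) F (hw.kernTerm D (F \ D)) 0

lemma measurable_kernTerm (hw : IsTemperedWeight μ w K) (D H : Finset ℕ) :
    Measurable (hw.kernTerm D H) :=
  ((hw.measurable_star _ _).mul (hw.measurable_boltz _ _)).mul
    ((hw.measurable_boltz _ _).mul (hw.measurable_corrAt _ _))

lemma kernTerm_congr (hw : IsTemperedWeight μ w K) {D H : Finset ℕ} (hD : D.Nonempty)
    {x y : ℕ → S} (h0 : x 0 = y 0) (h : ∀ i ∈ D ∪ H, x i = y i) :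
    hw.kernTerm D H x = hw.kernTerm D H y := by
  have hm : sInf (D : Set ℕ) ∈ D := Nat.sInf_mem (s := (D : Set ℕ)) hD
  have hDx : ∀ i ∈ D, x i = y i := fun i hi => h i (Finset.mem_union_left _ hi)
  have hHx : ∀ i ∈ H, x i = y i := fun i hi => h i (Finset.mem_union_right _ hi)
  rw [kernTerm, kernTerm, hw.star_congr h0 hDx,
    hw.boltz_congr (hDx _ hm) fun i hi => hDx i (Finset.mem_of_mem_erase hi),
    hw.boltz_congr (hDx _ hm) hHx, hw.corrAt_congr (y := y)]
  intro i hi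
  refine (Finset.mem_union.1 hi).elim (fun hi => hDx i (Finset.mem_of_mem_erase hi)) (hHx i)

lemma corrAt_singleton_eq_sum (hw : IsTemperedWeight μ w K) {B : Finset ℕ} (h0 : 0 ∉ B)
    (hB : B.Nonempty) (x : ℕ → S) :
    hw.corrAt {0} B x = ∑ E ∈ B.powerset, ∑ D ∈ (B \ E).powerset with D.Nonempty,
      hw.kernTerm D ((B \ E) \ D) x * hw.corrAt {sInf (D : Set ℕ)} E x := by
  have h := hw.corrAt_insert (A := ∅) (Finset.notMem_empty 0) h0 (Finset.disjoint_empty_left _) x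
  rw [insert_empty_eq] at h
  simp only [Finset.empty_union] at h
  have hb : hw.boltz 0 ∅ x = 1 := by simp [boltz]
  rw [h, hb, one_mul, ← Finset.sum_filter_of_ne (p := fun D : Finset ℕ => D.Nonempty)]
  · rw [Finset.sum_comm' (t' := B.powerset.filter fun D : Finset ℕ => D.Nonempty)
      (s' := fun D => (B \ D).powerset)]
    · refine Finset.sum_congr rfl fun D hD => ?_
      rw [Finset.mem_filter, Finset.mem_powerset] at hD
      have hm : sInf (D : Set ℕ) ∈ D := Nat.sInf_mem (s := (D : Set ℕ)) hD.2
      have h2 := hw.corrAt_insert_eq_conv (A := D.erase (sInf (D : Set ℕ))) (B := B \ D)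
        (Finset.notMem_erase _ _) (fun h => (Finset.mem_sdiff.1 h).2 hm)
        (Finset.disjoint_sdiff.mono_left (Finset.erase_subset _ _)) x
      rw [Finset.insert_erase hm] at h2
      rw [h2, Finset.mul_sum, Finset.mul_sum]
      refine Finset.sum_congr rfl fun E hE => ?_
      rw [kernTerm, sdiff_right_comm]
      ring
    · intro E D
      simp only [Finset.mem_powerset, Finset.mem_filter, Finset.subset_sdiff]
      constructor
      · rintro ⟨hE, ⟨hD, hd⟩, hne⟩
        exact ⟨⟨hE, hd.symm⟩, hD, hne⟩
      · rintro ⟨⟨hE, hd⟩, hD, hne⟩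
        exact ⟨hE, ⟨hD, hd.symm⟩, hne⟩
  · intro D _ hne
    rw [Finset.nonempty_iff_ne_empty]
    rintro rfl
    simp [corrAt_empty_left, hB.ne_empty] at hne

lemma kernIntegral_empty (hw : IsTemperedWeight μ w K) : hw.kernIntegral ∅ = 0 := by
  rw [kernIntegral]
  refine Finset.sum_eq_zero fun D hD => ?_
  simp at hD
  simp [hD.1] at hD

variable [SigmaFinite μ]

lemma kernIntegral_le (hw : IsTemperedWeight μ w K) {F : Finset ℕ} (h0 : 0 ∉ F)
    {p : ℕ} (hp : F.card = p + 1) : hw.kernIntegral F ≤ (p ^ p : ℕ) * K ^ (p + 1) := by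
  have hterm : ∀ D ∈ F.powerset, D.Nonempty →
      lmarginal (fun _ => μ) F (hw.kernTerm D (F \ D)) 0 ≤
        (forestCount (D.card - 1) (p + 1 - D.card) : ℝ≥0∞) * K ^ (p + 1) := by
    intro D hD hne
    rw [Finset.mem_powerset] at hD
    have hm : sInf (D : Set ℕ) ∈ D := Nat.sInf_mem (s := (D : Set ℕ)) hne
    have hle : hw.kernTerm D (F \ D) ≤
        fun x => hw.star 0 D x * hw.corrAt (D.erase (sInf (D : Set ℕ))) (F \ D) x := by
      intro x
      rw [kernTerm]
      exact mul_le_mul' (mul_le_of_le_one_right' (hw.boltz_le_one _ _ x))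
        (mul_le_of_le_one_left' (hw.boltz_le_one _ _ x))
    refine (lmarginal_mono hle 0).trans ?_
    have hc : (F \ D).card = p + 1 - D.card := hp ▸ Finset.card_sdiff_of_subset hD
    have hcard : D.card ≤ p + 1 := hp ▸ Finset.card_le_card hD
    refine (hw.lmarginal_star_mul_le h0 hD (hw.measurable_corrAt _ _) (fun x =>
      hw.lmarginal_corrAt_le (Finset.disjoint_sdiff.mono_left (Finset.erase_subset _ _)) x)
      0).trans_eq ?_
    rw [Finset.card_erase_of_mem hm, hc, mul_left_comm, ← pow_add, Nat.add_sub_cancel' hcard]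
  have hle : hw.kernIntegral F ≤ ∑ D ∈ F.powerset, (if D.card = 0 then 0 else
      (forestCount (D.card - 1) (p + 1 - D.card) : ℝ≥0∞)) * K ^ (p + 1) := by
    rw [kernIntegral, Finset.sum_filter]
    refine Finset.sum_le_sum fun D hD => ?_
    by_cases hne : D.Nonempty
    · rw [if_pos hne, if_neg (Finset.card_ne_zero.2 hne)]
      exact hterm D hD hne
    · rw [if_neg hne]; exact zero_le
  refine hle.trans_eq ?_
  rw [← Finset.sum_mul, Finset.sum_powerset_apply_card fun k => if k = 0 then 0 else
      (forestCount (k - 1) (p + 1 - k) : ℝ≥0∞), hp, Finset.sum_range_succ',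
      ← sum_choose_succ_mul_forestCount p]
  push_cast
  simp

lemma lmarginal_corrAt_singleton_eq_sum (hw : IsTemperedWeight μ w K) {B : Finset ℕ}
    (h0 : 0 ∉ B) (hB : B.Nonempty) (J : ℕ → ℝ≥0∞)
    (hJ : ∀ {y : ℕ} {E : Finset ℕ}, y ∉ E → ∀ x,
      lmarginal (fun _ => μ) E (hw.corrAt {y} E) x = J E.card) :
    J B.card = ∑ E ∈ B.powerset, J E.card * hw.kernIntegral (B \ E) := by
  rw [← hJ h0 0, funext (hw.corrAt_singleton_eq_sum h0 hB), lmarginal_finset_sum 0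
    (f := fun E x => ∑ D ∈ (B \ E).powerset with D.Nonempty,
      hw.kernTerm D ((B \ E) \ D) x * hw.corrAt {sInf (D : Set ℕ)} E x) fun E _ =>
      Finset.measurable_sum _ fun D _ =>
        (hw.measurable_kernTerm _ _).mul (hw.measurable_corrAt _ _)]
  refine Finset.sum_congr rfl fun E hE => ?_
  rw [Finset.mem_powerset] at hE
  rw [lmarginal_finset_sum 0 (f := fun D x =>
      hw.kernTerm D ((B \ E) \ D) x * hw.corrAt {sInf (D : Set ℕ)} E x) fun D _ =>
        (hw.measurable_kernTerm _ _).mul (hw.measurable_corrAt _ _), kernIntegral, Finset.mul_sum]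
  refine Finset.sum_congr rfl fun D hD => ?_
  rw [Finset.mem_filter, Finset.mem_powerset] at hD
  have hm : sInf (D : Set ℕ) ∈ D := Nat.sInf_mem (s := (D : Set ℕ)) hD.2
  have h1 : lmarginal (fun _ => μ) B (fun x => hw.kernTerm D ((B \ E) \ D) x *
      hw.corrAt {sInf (D : Set ℕ)} E x) 0 = lmarginal (fun _ => μ) ((B \ E) ∪ E)
      (fun x => hw.kernTerm D ((B \ E) \ D) x * hw.corrAt {sInf (D : Set ℕ)} E x) 0 := by
    rw [Finset.sdiff_union_of_subset hE]
  rw [h1, lmarginal_union (fun _ => μ) (fun x => hw.kernTerm D ((B \ E) \ D) x *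
    hw.corrAt {sInf (D : Set ℕ)} E x)
    ((hw.measurable_kernTerm _ _).mul (hw.measurable_corrAt _ _)) Finset.sdiff_disjoint]
  have h2 : lmarginal (fun _ => μ) E (fun x => hw.kernTerm D ((B \ E) \ D) x *
      hw.corrAt {sInf (D : Set ℕ)} E x) = fun x => J E.card * hw.kernTerm D ((B \ E) \ D) x := by
    funext x
    rw [lmarginal_const_mul_of_updateFinset (hw.measurable_corrAt _ _), hJ, mul_comm]
    · exact fun h => (Finset.mem_sdiff.1 (hD.1 hm)).2 h
    · intro z
      refine hw.kernTerm_congr hD.2 ?_ fun i hi => ?_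
      · have : 0 ∉ E := fun h => h0 (hE h)
        simp [Function.updateFinset, this]
      · have : i ∉ E := by
          rw [Finset.union_sdiff_of_subset hD.1] at hi
          exact (Finset.mem_sdiff.1 hi).2
        simp [Function.updateFinset, this]
  rw [h2, lmarginal_const_mul_of_updateFinset (k := fun _ => J E.card)
    (hw.measurable_kernTerm _ _) fun _ => rfl]

lemma lmarginal_corrAt_singleton [MeasurableAdd S] [μ.IsAddLeftInvariant]
    (hw : IsTemperedWeight μ w K) {y : ℕ} {E : Finset ℕ} (hy : y ∉ E) (x : ℕ → S) :
    lmarginal (fun _ => μ) E (hw.corrAt {y} E) x = hw.rootIntegral E.card := by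
  set n := E.card with hn
  set e : Fin n ↪ ℕ := (E.orderEmbOfFin rfl).toEmbedding with he
  have hmap : Finset.univ.map e = E := Finset.map_orderEmbOfFin_univ E rfl
  have himg : Finset.univ.image e = E := by rw [← Finset.map_eq_image, hmap]
  have hye : y ∉ Set.range e := by
    rintro ⟨i, rfl⟩
    exact hy (hmap ▸ Finset.mem_map_of_mem e (Finset.mem_univ i))
  let e' : Fin (n + 1) ↪ ℕ :=
    ⟨Fin.cons y e, Fin.cons_injective_iff.2 ⟨hye, e.injective⟩⟩
  have hA : ({0} : Finset (Fin (n + 1))).map e' = {y} := by simp [e']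
  have hB : (Finset.univ.map (Fin.succEmb n)).map e' = E := by
    rw [Finset.map_map, ← hmap]
    congr 1
  have hroot : ∀ c : S, ∀ z : Fin n → S,
      hw.corrAt {0} (Finset.univ.map (Fin.succEmb n)) (Fin.cons c ((fun _ => c) + z)) =
        hw.corrAt {0} (Finset.univ.map (Fin.succEmb n)) (Fin.cons 0 z) := by
    intro c z
    have hz : (Fin.cons c ((fun _ => c) + z) : Fin (n + 1) → S) =
        fun i => c + (Fin.cons 0 z : Fin (n + 1) → S) i := by
      funext i
      refine Fin.cases ?_ (fun i => ?_) i <;> simp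
    rw [corrAt, corrAt, corr_map (Function.Embedding.refl _)
      (v' := configWeight w hw.symm (Fin.cons 0 z))]
    · simp
    · intro i _ j _
      rw [hz]
      simp [hw.add_left]
  let f : (Fin n → S) → ℝ≥0∞ := fun z =>
    hw.corrAt {0} (Finset.univ.map (Fin.succEmb n)) (Fin.cons (x y) z : Fin (n + 1) → S)
  have hf : Measurable f := by
    refine (hw.measurable_corrAt _ _).comp (measurable_pi_iff.2 fun i => ?_)
    refine Fin.cases ?_ (fun i => ?_) i
    · simp
    · simpa using measurable_pi_apply i
  have h1 : lmarginal (fun _ => μ) E (hw.corrAt {y} E) x =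
      lmarginal (fun _ => μ) E (fun x => f fun i => x (e i)) x := by
    refine lintegral_congr fun z => ?_
    symm
    simp only [f, corrAt]
    rw [corr_map e' (v' := configWeight w hw.symm (Function.updateFinset x E z)), hA, hB]
    have : ∀ i, (Fin.cons (x y) (fun i => Function.updateFinset x E z (e i)) :
        Fin (n + 1) → S) i = Function.updateFinset x E z (e' i) := by
      intro i
      refine Fin.cases ?_ (fun i => ?_) i
      · simp [e', Function.updateFinset, hy]
      · rfl
    intro i _ j _
    simp only [configWeight_mk, this]
  have h2 := lmarginal_image (μ := fun _ : ℕ => μ) e.injective Finset.univ hf x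
  rw [himg, lmarginal_univ] at h2
  rw [h1]
  refine h2.trans ?_
  have h3 := lintegral_add_left_eq_self (μ := Measure.pi fun _ : Fin n => μ) f (fun _ => x y)
  refine h3.symm.trans ?_
  rw [rootIntegral]
  exact lintegral_congr fun z => hroot _ z

end IsTemperedWeight

namespace IsTemperedWeight

variable {S : Type*} [AddCommGroup S] [MeasurableSpace S] [MeasurableAdd S] {μ : Measure S}
  [SigmaFinite μ] [μ.IsAddLeftInvariant] {w : S → S → ℝ} {K : ℝ≥0∞}

/-- The value of `kernIntegral` on the sets of `m` points. -/
def kernCoeff (hw : IsTemperedWeight μ w K) (m : ℕ) : ℝ≥0∞ :=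
  hw.kernIntegral ((Finset.range m).map (addRightEmbedding 1))

lemma rootIntegral_zero (hw : IsTemperedWeight μ w K) : hw.rootIntegral 0 = 1 := by
  rw [← Finset.card_empty (α := ℕ), ← hw.lmarginal_corrAt_singleton (Finset.notMem_empty 0) 0]
  rw [lmarginal_empty, corrAt, corr_empty_right,
    ← insert_empty_eq, pairWeight_insert _ (Finset.notMem_empty _)]
  simp [pairWeight_empty]

lemma rootIntegral_ne_top (hw : IsTemperedWeight μ w K) (hK : K ≠ ∞) (n : ℕ) :
    hw.rootIntegral n ≠ ∞ := by
  have h0 : 0 ∉ (Finset.range n).map (addRightEmbedding 1) := by simp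
  have h1 := hw.lmarginal_corrAt_le (Finset.disjoint_singleton_left.2 h0) 0
  rw [hw.lmarginal_corrAt_singleton h0, Finset.card_map, Finset.card_range] at h1
  exact ne_top_of_le_ne_top (ENNReal.mul_ne_top (ENNReal.natCast_ne_top _)
    (ENNReal.pow_ne_top hK)) h1

lemma rootIntegral_eq_add (hw : IsTemperedWeight μ w K) {F : Finset ℕ} (h0 : 0 ∉ F)
    (hF : F.Nonempty) (ih : ∀ G : Finset ℕ, 0 ∉ G → G.card < F.card →
      hw.kernIntegral G = hw.kernCoeff G.card) :
    hw.rootIntegral F.card = hw.kernIntegral F + ∑ k ∈ Finset.range F.card,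
      (F.card.choose (k + 1) : ℝ≥0∞) *
        (hw.rootIntegral (k + 1) * hw.kernCoeff (F.card - (k + 1))) := by
  have h := hw.lmarginal_corrAt_singleton_eq_sum h0 hF hw.rootIntegral
    hw.lmarginal_corrAt_singleton
  rw [← Finset.add_sum_erase _ _ (Finset.empty_mem_powerset F), Finset.card_empty,
    rootIntegral_zero, one_mul, Finset.sdiff_empty] at h
  rw [h]
  congr 1
  have h1 : ∀ E ∈ F.powerset.erase ∅, hw.rootIntegral E.card * hw.kernIntegral (F \ E) =
      if E.card = 0 then 0 else hw.rootIntegral E.card * hw.kernCoeff (F.card - E.card) := by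
    intro E hE
    rw [Finset.mem_erase, Finset.mem_powerset] at hE
    have hc := Finset.card_pos.2 (Finset.nonempty_iff_ne_empty.2 hE.1)
    have hcF := Finset.card_le_card hE.2
    have hs : (F \ E).card = F.card - E.card := Finset.card_sdiff_of_subset hE.2
    rw [if_neg hc.ne', ih _ (fun h => h0 (Finset.sdiff_subset h)) (by omega), hs]
  rw [Finset.sum_congr rfl h1, Finset.sum_erase _ (by simp), Finset.sum_powerset_apply_card
    (fun k => if k = 0 then 0 else hw.rootIntegral k * hw.kernCoeff (F.card - k)),
    Finset.sum_range_succ']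
  simp

lemma kernIntegral_eq_kernCoeff (hw : IsTemperedWeight μ w K) (hK : K ≠ ∞) {F : Finset ℕ}
    (h0 : 0 ∉ F) : hw.kernIntegral F = hw.kernCoeff F.card := by
  induction hn : F.card using Nat.strong_induction_on generalizing F with
  | h n ih =>
    rcases F.eq_empty_or_nonempty with rfl | hF
    · subst hn; simp [kernCoeff]
    set G := (Finset.range n).map (addRightEmbedding 1) with hG
    have hGc : G.card = n := by simp [hG]
    have hG0 : 0 ∉ G := by simp [hG]
    have hn0 : 0 < n := hn ▸ Finset.card_pos.2 hF
    have h1 := hw.rootIntegral_eq_add h0 hF fun E hE hlt => ih _ (hn ▸ hlt) hE rfl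
    have h2 := hw.rootIntegral_eq_add hG0 (Finset.card_pos.1 (hGc ▸ hn0))
      fun E hE hlt => ih _ (hGc ▸ hlt) hE rfl
    rw [hn] at h1
    rw [hGc, h1] at h2
    refine (ENNReal.add_left_inj ?_).1 h2
    refine ne_top_of_le_ne_top (hw.rootIntegral_ne_top hK n) ?_
    rw [h1]
    exact le_add_self

/-- The cluster integrals satisfy a renewal equation with small nonnegative coefficients. -/
lemma exists_renewal (hw : IsTemperedWeight μ w K) (hK : K ≠ ∞) : ∃ r : ℕ → ℝ, r 0 = 0 ∧
    (∀ m, 0 ≤ r m) ∧ (∀ p : ℕ, r (p + 1) ≤ (p : ℝ) ^ p * K.toReal ^ (p + 1)) ∧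
    ∀ n, n ≠ 0 → (hw.rootIntegral n).toReal = ∑ k ∈ Finset.range (n + 1),
      (n.choose k : ℝ) * ((hw.rootIntegral k).toReal * r (n - k)) := by
  have hle : ∀ p : ℕ, hw.kernCoeff (p + 1) ≤ (p ^ p : ℕ) * K ^ (p + 1) := fun p =>
    hw.kernIntegral_le (by simp) (by simp)
  have hfin : ∀ p : ℕ, ((p ^ p : ℕ) : ℝ≥0∞) * K ^ (p + 1) ≠ ∞ := fun p =>
    ENNReal.mul_ne_top (ENNReal.natCast_ne_top _) (ENNReal.pow_ne_top hK)
  have hzero : hw.kernCoeff 0 = 0 := by simp [kernCoeff, kernIntegral_empty]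
  refine ⟨fun m => (hw.kernCoeff m).toReal, by simp [hzero],
    fun m => ENNReal.toReal_nonneg, fun p => ?_, fun n hn => ?_⟩
  · simpa using ENNReal.toReal_mono (hfin p) (hle p)
  · have hk : ∀ m, hw.kernCoeff m ≠ ∞ := by
      rintro (_ | p)
      · simp [hzero]
      · exact ne_top_of_le_ne_top (hfin p) (hle p)
    set G := (Finset.range n).map (addRightEmbedding 1) with hG
    have hGc : G.card = n := by simp [hG]
    have hG0 : 0 ∉ G := by simp [hG]
    have h := hw.lmarginal_corrAt_singleton_eq_sum hG0
      (Finset.card_pos.1 (hGc ▸ Nat.pos_of_ne_zero hn)) hw.rootIntegral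
      hw.lmarginal_corrAt_singleton
    have h1 : ∀ E ∈ G.powerset, hw.rootIntegral E.card * hw.kernIntegral (G \ E) =
        hw.rootIntegral E.card * hw.kernCoeff (n - E.card) := by
      intro E hE
      rw [hw.kernIntegral_eq_kernCoeff hK (fun h => hG0 (Finset.sdiff_subset h)),
        Finset.card_sdiff_of_subset (Finset.mem_powerset.1 hE), hGc]
    rw [Finset.sum_congr rfl h1, Finset.sum_powerset_apply_card
      fun k => hw.rootIntegral k * hw.kernCoeff (n - k), hGc] at h
    rw [h, ENNReal.toReal_sum]
    · simp
    · intro k _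
      rw [nsmul_eq_mul]
      exact ENNReal.mul_ne_top (ENNReal.natCast_ne_top _)
        (ENNReal.mul_ne_top (hw.rootIntegral_ne_top hK k) (hk _))

end IsTemperedWeight

lemma pairW_nonneg {d : ℕ} (β : ℝ) (φ : (Fin d → ℝ) → ℝ≥0∞) (x y : Fin d → ℝ) :
    0 ≤ pairW β φ x y := by
  rw [pairW]; split_ifs <;> positivity

lemma pairW_sub {d : ℕ} (β : ℝ) (φ : (Fin d → ℝ) → ℝ≥0∞) (x y : Fin d → ℝ) :
    pairW β φ x y = pairW β φ (x - y) 0 := by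
  simp [pairW]

lemma isTemperedWeight_pairW {d : ℕ} {β : ℝ} (hβ : 0 < β) {φ : (Fin d → ℝ) → ℝ≥0∞}
    (hφm : Measurable φ) (hφeven : ∀ v, φ (-v) = φ v) :
    IsTemperedWeight volume (pairW β φ) (Cbeta β φ) where
  symm a b := by
    rw [pairW, pairW, ← hφeven, neg_sub]
  nonneg := pairW_nonneg β φ
  le_one a b := by
    rw [pairW]
    split_ifs
    · exact zero_le_one
    · rw [Real.exp_le_one_iff]
      have := ENNReal.toReal_nonneg (a := φ (a - b))
      nlinarith [mul_nonneg hβ.le this]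
  measurable := by
    have h : Measurable fun p : (Fin d → ℝ) × (Fin d → ℝ) => φ (p.1 - p.2) :=
      hφm.comp (measurable_fst.sub measurable_snd)
    exact Measurable.ite (h (measurableSet_singleton _)) measurable_const
      (Real.measurable_exp.comp (h.ennreal_toReal.const_mul β).neg)
  add_left c a b := by
    rw [pairW_sub, pairW_sub β φ a b, add_sub_add_left_eq_sub]
  lintegral_le a := by
    refine le_of_eq ?_
    rw [Cbeta, ← lintegral_sub_left_eq_self (fun v => ENNReal.ofReal (1 - pairW β φ v 0)) a]
    exact lintegral_congr fun b => by rw [pairW_sub]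

lemma bCoef_eq {d : ℕ} {β : ℝ} {φ : (Fin d → ℝ) → ℝ≥0∞}
    (hw : IsTemperedWeight volume (pairW β φ) (Cbeta β φ)) (n : ℕ) :
    bCoef β φ n = (-1) ^ n * (hw.rootIntegral n).toReal := by
  have hd : Disjoint ({0} : Finset (Fin (n + 1))) (Finset.univ.map (Fin.succEmb n)) := by
    simp [Fin.succ_ne_zero]
  have hm : Measurable fun y : Fin n → Fin d → ℝ =>
      (Fin.cons 0 y : Fin (n + 1) → Fin d → ℝ) := by
    refine measurable_pi_iff.2 fun i => ?_
    refine Fin.cases ?_ (fun i => ?_) i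
    · simp
    · simpa using measurable_pi_apply i
  simp only [bCoef, omegaT_eq_corr (pairW β φ) hw.symm]
  rw [integral_const_mul, integral_eq_lintegral_of_nonneg_ae]
  · rfl
  · exact .of_forall fun y =>
      corr_nonneg (hw.configWeight_nonneg _) (hw.configWeight_le_one _) hd
  · exact ((hw.measurable_corr _ _).comp hm).aestronglyMeasurable

lemma PowerSeries.coeff_trunc_pow {R : Type*} [CommSemiring R] (f : PowerSeries R) (n k : ℕ) :
    ((PowerSeries.trunc (n + 1) f) ^ k).coeff n = PowerSeries.coeff n (f ^ k) := by
  rw [← Polynomial.coeff_coe, Polynomial.coe_pow,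
    ← PowerSeries.coeff_coe_trunc_of_lt (Nat.lt_succ_self n), PowerSeries.trunc_trunc_pow,
    PowerSeries.coeff_coe_trunc_of_lt (Nat.lt_succ_self n)]

/-- The exponential generating series of `y`, without its constant term. -/
def expSeries (y : ℕ → ℝ) : PowerSeries ℝ :=
  PowerSeries.mk fun i => if i = 0 then 0 else y i / i.factorial

lemma bellPoly_eq_coeff {n k : ℕ} (hk : k ≤ n) (y : ℕ → ℝ) :
    k.factorial * BellPoly n k y = n.factorial * PowerSeries.coeff n (expSeries y ^ k) := by
  set a : ℕ → ℝ := fun i => y (i + 1) / (i + 1).factorial with ha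
  have hF : expSeries y = PowerSeries.X * PowerSeries.mk a := by
    ext i
    cases i with
    | zero => simp [expSeries]
    | succ i => simp [expSeries, ha, PowerSeries.coeff_succ_X_mul]
  have htr : PowerSeries.trunc (n - k + 1) (PowerSeries.mk a) =
      ∑ i : Fin (n - k + 1), Polynomial.C (a i) * Polynomial.X ^ (i : ℕ) := by
    rw [Fin.sum_univ_eq_sum_range (fun i => Polynomial.C (a i) * Polynomial.X ^ i) (n - k + 1)]
    ext m
    simp [PowerSeries.coeff_trunc, Polynomial.finsetSum_coeff]
  have hcoeff : PowerSeries.coeff n (expSeries y ^ k) =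
      ∑ α ∈ Finset.piAntidiag Finset.univ k, if (∑ i : Fin (n - k + 1), i.1 * α i) = n - k then
        (Nat.multinomial Finset.univ α : ℝ) * ∏ i : Fin (n - k + 1), a i ^ α i else 0 := by
    have hX : PowerSeries.coeff n (expSeries y ^ k) =
        PowerSeries.coeff (n - k) (PowerSeries.mk a ^ k) := by
      conv_lhs => rw [hF, mul_pow, ← Nat.sub_add_cancel hk, PowerSeries.coeff_X_pow_mul]
    rw [hX, ← PowerSeries.coeff_trunc_pow, htr, Finset.sum_pow_eq_sum_piAntidiag,
      Polynomial.finsetSum_coeff]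
    refine Finset.sum_congr rfl fun α _ => ?_
    simp only [mul_pow, ← pow_mul, ← Polynomial.C_pow, Finset.prod_mul_distrib,
      Finset.prod_pow_eq_pow_sum]
    rw [← map_prod (Polynomial.C (R := ℝ)), ← Polynomial.C_eq_natCast, ← mul_assoc,
      ← Polynomial.C_mul, Polynomial.coeff_C_mul_X_pow]
    simp only [eq_comm]
  rw [hcoeff, BellPoly, Finset.mul_sum, Finset.mul_sum, ← Finset.sum_filter_of_ne
    (p := fun α : Fin (n - k + 1) → ℕ => (∑ i : Fin (n - k + 1), i.1 * α i) = n - k)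
    (s := Finset.piAntidiag Finset.univ k)]
  · refine Finset.sum_congr ?_ fun α hα => ?_
    · ext α
      have h1 : ∑ i : Fin (n - k + 1), (i.1 + 1) * α i =
          (∑ i : Fin (n - k + 1), i.1 * α i) + ∑ i, α i := by
        simp only [add_mul, one_mul, Finset.sum_add_distrib]
      simp only [Finset.mem_filter, Fintype.mem_piFinset, Finset.mem_range,
        Finset.mem_piAntidiag, h1]
      constructor
      · rintro ⟨_, h2, h3⟩
        exact ⟨⟨h2, fun i _ => Finset.mem_univ i⟩, by omega⟩
      · rintro ⟨⟨h2, _⟩, h3⟩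
        replace h2 : ∑ i, α i = k := h2
        refine ⟨fun i => ?_, h2, by omega⟩
        have := Finset.single_le_sum (f := α) (fun j _ => Nat.zero_le _) (Finset.mem_univ i)
        omega
    · simp only [Finset.mem_filter, Finset.mem_piAntidiag] at hα
      rw [if_pos hα.2]
      have hm := congrArg (Nat.cast (R := ℝ)) (Nat.multinomial_spec Finset.univ α)
      rw [hα.1.1] at hm
      push_cast at hm
      have hne : (∏ i, ((α i).factorial : ℝ)) ≠ 0 :=
        Finset.prod_ne_zero_iff.2 fun i _ => Nat.cast_ne_zero.2 (Nat.factorial_ne_zero _)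
      rw [← hm]
      field_simp
      rfl
  · intro α _ hne
    by_contra h
    simp [h] at hne

lemma genBinom_neg_succ (d k : ℕ) :
    genBinom (-((d + 1 : ℕ) : ℝ)) k = (-1) ^ k * (d + k).choose d := by
  have h1 : ∏ i ∈ Finset.range k, (-((d + 1 : ℕ) : ℝ) - i) =
      (-1) ^ k * ((d + 1).ascFactorial k : ℕ) := by
    rw [Nat.ascFactorial_eq_prod_range, Nat.cast_prod]
    conv_rhs => rw [← Finset.card_range k, ← Finset.prod_const, Finset.card_range,
      ← Finset.prod_mul_distrib]
    exact Finset.prod_congr rfl fun i _ => by push_cast; ring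
  have hk : (k.factorial : ℝ) ≠ 0 := Nat.cast_ne_zero.2 (Nat.factorial_ne_zero k)
  rw [genBinom, h1, Nat.ascFactorial_eq_factorial_mul_choose, Nat.cast_mul,
    Nat.choose_symm_add]
  field_simp

lemma exists_sum_choose_mul_one_sub_pow (d m : ℕ) : ∃ q : Polynomial ℝ,
    (∑ k ∈ Finset.range (m + 1), Polynomial.C ((d + k).choose d : ℝ) * Polynomial.X ^ k) *
      (1 - Polynomial.X) ^ (d + 1) = 1 + Polynomial.X ^ (m + 1) * q := by
  set p := ∑ k ∈ Finset.range (m + 1),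
    Polynomial.C ((d + k).choose d : ℝ) * Polynomial.X ^ k with hp
  set g : PowerSeries ℝ := PowerSeries.mk fun n => ((d + n).choose d : ℝ) with hg
  have h : Polynomial.X ^ (m + 1) ∣ p * (1 - Polynomial.X) ^ (d + 1) - 1 := by
    rw [Polynomial.X_pow_dvd_iff]
    intro i hi
    have h1 := congrArg (PowerSeries.coeff i) (PowerSeries.mk_add_choose_mul_one_sub_pow_eq_one ℝ d)
    have h2 : ((p * (1 - Polynomial.X) ^ (d + 1) : Polynomial ℝ) : PowerSeries ℝ) =
        (p : PowerSeries ℝ) * (1 - PowerSeries.X) ^ (d + 1) := by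
      simp
    rw [Polynomial.coeff_sub, ← Polynomial.coeff_coe, h2, ← Polynomial.coeff_coe 1,
      Polynomial.coe_one, ← h1, sub_eq_zero, PowerSeries.coeff_mul, PowerSeries.coeff_mul]
    refine Finset.sum_congr rfl fun x hx => ?_
    have hx1 : x.1 < m + 1 := by
      have := Finset.HasAntidiagonal.mem_antidiagonal.1 hx
      omega
    congr 1
    simp [hp, Polynomial.finsetSum_coeff, hx1]
  obtain ⟨q, hq⟩ := h
  exact ⟨q, by rw [← hq]; ring⟩

lemma sum_genBinom_mul_coeff {F H : PowerSeries ℝ} (hF : PowerSeries.constantCoeff F = 0)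
    (hH : H * (1 + F) = 1) (d m : ℕ) :
    ∑ k ∈ Finset.range (m + 1), genBinom (-((d + 1 : ℕ) : ℝ)) k * PowerSeries.coeff m (F ^ k) =
      PowerSeries.coeff m (H ^ (d + 1)) := by
  obtain ⟨q, hq⟩ := exists_sum_choose_mul_one_sub_pow d m
  have h := congrArg (Polynomial.aeval (-F)) hq
  simp only [map_mul, map_sum, map_pow, map_sub, map_add, map_one, Polynomial.aeval_X,
    Polynomial.aeval_C, sub_neg_eq_add] at h
  set G := Polynomial.aeval (-F) q
  have hX : PowerSeries.X ∣ F := PowerSeries.X_dvd_iff.2 hF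
  have h2 : ∑ k ∈ Finset.range (m + 1),
      algebraMap ℝ (PowerSeries ℝ) ((d + k).choose d : ℝ) * (-F) ^ k =
      H ^ (d + 1) + (-F) ^ (m + 1) * (G * H ^ (d + 1)) := by
    calc _ = (∑ k ∈ Finset.range (m + 1),
          algebraMap ℝ (PowerSeries ℝ) ((d + k).choose d : ℝ) * (-F) ^ k) *
          (H * (1 + F)) ^ (d + 1) := by rw [hH, one_pow, mul_one]
      _ = ((∑ k ∈ Finset.range (m + 1),
          algebraMap ℝ (PowerSeries ℝ) ((d + k).choose d : ℝ) * (-F) ^ k) *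
          (1 + F) ^ (d + 1)) * H ^ (d + 1) := by rw [mul_pow]; ring
      _ = _ := by rw [h]; ring
  have h3 : PowerSeries.coeff m ((-F) ^ (m + 1) * (G * H ^ (d + 1))) = 0 := by
    refine PowerSeries.X_pow_dvd_iff.1 ?_ m (Nat.lt_succ_self m)
    exact Dvd.dvd.mul_right (pow_dvd_pow_of_dvd ((dvd_neg).2 hX) _) _
  have h4 := congrArg (PowerSeries.coeff m) h2
  rw [map_add, h3, add_zero, map_sum] at h4
  rw [← h4]
  refine Finset.sum_congr rfl fun k _ => ?_
  rw [genBinom_neg_succ, ← Algebra.smul_def, map_smul, smul_eq_mul, ← neg_one_smul ℝ F,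
    smul_pow, map_smul, smul_eq_mul]
  ring

lemma abs_coeff_pow_le {f g : PowerSeries ℝ}
    (h : ∀ n, |PowerSeries.coeff n f| ≤ PowerSeries.coeff n g) (k n : ℕ) :
    |PowerSeries.coeff n (f ^ k)| ≤ PowerSeries.coeff n (g ^ k) := by
  induction k generalizing n with
  | zero =>
    rw [pow_zero, pow_zero, PowerSeries.coeff_one]
    split_ifs <;> simp
  | succ k ih =>
    rw [pow_succ, pow_succ, PowerSeries.coeff_mul, PowerSeries.coeff_mul]
    refine (Finset.abs_sum_le_sum_abs _ _).trans (Finset.sum_le_sum fun x _ => ?_)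
    rw [abs_mul]
    exact mul_le_mul (ih _) (h _) (abs_nonneg _) ((abs_nonneg _).trans (ih _))

lemma coeff_pow_mul_pow_le {g : PowerSeries ℝ} (hg : ∀ n, 0 ≤ PowerSeries.coeff n g) {t : ℝ}
    (ht : 0 ≤ t) (k n : ℕ) : PowerSeries.coeff n (g ^ k) * t ^ n ≤
      (∑ i ∈ Finset.range (n + 1), PowerSeries.coeff i g * t ^ i) ^ k := by
  set p := PowerSeries.trunc (n + 1) g with hp
  have h1 : (∑ i ∈ Finset.range (n + 1), PowerSeries.coeff i g * t ^ i) ^ k =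
      (p ^ k).eval t := by
    rw [Polynomial.eval_pow, ← Polynomial.eval₂_id, hp,
      PowerSeries.eval₂_trunc_eq_sum_range]
    rfl
  have h0 : ∀ k i, 0 ≤ (p ^ k).coeff i := by
    intro k
    induction k with
    | zero => intro i; rw [pow_zero, Polynomial.coeff_one]; split_ifs <;> simp
    | succ k ih =>
      intro i
      rw [pow_succ, Polynomial.coeff_mul]
      refine Finset.sum_nonneg fun x _ => mul_nonneg (ih _) ?_
      rw [hp, PowerSeries.coeff_trunc]
      split_ifs
      exacts [hg _, le_rfl]
  rw [h1, ← PowerSeries.coeff_trunc_pow]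
  by_cases hn : n ∈ (p ^ k).support
  · rw [Polynomial.eval_eq_sum, Polynomial.sum]
    exact Finset.single_le_sum (f := fun i => (p ^ k).coeff i * t ^ i)
      (fun i _ => mul_nonneg (h0 k i) (pow_nonneg ht i)) hn
  · rw [Polynomial.notMem_support_iff.1 hn, zero_mul, Polynomial.eval_eq_sum, Polynomial.sum]
    exact Finset.sum_nonneg fun i _ => mul_nonneg (h0 k i) (pow_nonneg ht i)

/-- The coefficients `1, C, C²/2!, …, p^p C^(p+1)/(p+1)!, …` of `1 + T₁` after scaling by `C`. -/
def treeMajorant (C : ℝ) : PowerSeries ℝ :=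
  PowerSeries.mk fun i => if i = 0 then 1 else
    ((i - 1 : ℕ) : ℝ) ^ (i - 1) * C ^ i / i.factorial

lemma coeff_treeMajorant_nonneg {C : ℝ} (hC : 0 ≤ C) (n : ℕ) :
    0 ≤ PowerSeries.coeff n (treeMajorant C) := by
  rw [treeMajorant, PowerSeries.coeff_mk]
  split_ifs <;> positivity

lemma T1_term_nonneg {r : ℝ} (hr : 0 ≤ r) (n : ℕ) :
    0 ≤ ((n : ℝ) + 1) ^ (n + 1) * r ^ (n + 2) / ((n + 2).factorial : ℝ) := by
  positivity

lemma summable_T1 {r : ℝ} (hr : 0 ≤ r) (hr1 : r < Real.exp (-1)) :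
    Summable fun n : ℕ => ((n : ℝ) + 1) ^ (n + 1) * r ^ (n + 2) / ((n + 2).factorial : ℝ) := by
  have hq : Real.exp 1 * r < 1 := by
    calc Real.exp 1 * r < Real.exp 1 * Real.exp (-1) := by gcongr
      _ = 1 := by rw [← Real.exp_add]; simp
  have hg : Summable fun n : ℕ => (Real.exp 1 * r) ^ (n + 1) * r :=
    ((summable_nat_add_iff 1).2
      (summable_geometric_of_lt_one (by positivity) hq)).mul_right r
  refine Summable.of_nonneg_of_le (T1_term_nonneg hr) (fun n => ?_) hg
  have h1 : ((n : ℝ) + 1) ^ (n + 1) / ((n + 1).factorial : ℝ) ≤ Real.exp 1 ^ (n + 1) := by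
    have := Real.pow_div_factorial_le_exp ((n : ℝ) + 1) (by positivity) (n + 1)
    rwa [← Nat.cast_add_one, ← mul_one ((n + 1 : ℕ) : ℝ), Real.exp_nat_mul, mul_one,
      Nat.cast_add_one] at this
  have h2 : ((n : ℝ) + 1) ^ (n + 1) / ((n + 2).factorial : ℝ) ≤ Real.exp 1 ^ (n + 1) := by
    refine le_trans ?_ h1
    gcongr
    omega
  calc ((n : ℝ) + 1) ^ (n + 1) * r ^ (n + 2) / ((n + 2).factorial : ℝ)
      = ((n : ℝ) + 1) ^ (n + 1) / ((n + 2).factorial : ℝ) * r ^ (n + 2) := by ring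
    _ ≤ Real.exp 1 ^ (n + 1) * r ^ (n + 2) := by gcongr
    _ = _ := by ring

lemma T1_nonneg {r : ℝ} (hr : 0 ≤ r) : 0 ≤ T1 r :=
  add_nonneg hr (tsum_nonneg (T1_term_nonneg hr))

lemma sum_treeMajorant_le {C r : ℝ} (hC : 0 < C) (hr : 0 ≤ r) (hr1 : r < Real.exp (-1)) (n : ℕ) :
    ∑ i ∈ Finset.range (n + 1), PowerSeries.coeff i (treeMajorant C) * (r / C) ^ i ≤ 1 + T1 r := by
  have hnn : ∀ i, 0 ≤ PowerSeries.coeff i (treeMajorant C) * (r / C) ^ i := fun i =>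
    mul_nonneg (coeff_treeMajorant_nonneg hC.le i) (by positivity)
  calc ∑ i ∈ Finset.range (n + 1), PowerSeries.coeff i (treeMajorant C) * (r / C) ^ i
      ≤ ∑ i ∈ Finset.range (n + 2), PowerSeries.coeff i (treeMajorant C) * (r / C) ^ i :=
        Finset.sum_le_sum_of_subset_of_nonneg (Finset.range_mono (by omega)) fun i _ _ => hnn i
    _ = ∑ i ∈ Finset.range n,
          ((i : ℝ) + 1) ^ (i + 1) * r ^ (i + 2) / ((i + 2).factorial : ℝ) + r + 1 := by
        rw [Finset.sum_range_succ', Finset.sum_range_succ']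
        congr 1
        · congr 1
          · refine Finset.sum_congr rfl fun i _ => ?_
            simp only [treeMajorant, PowerSeries.coeff_mk]
            rw [if_neg (by omega), div_pow]
            simp only [add_assoc, Nat.reduceAdd, Nat.add_succ_sub_one]
            push_cast
            field_simp
          · simp [treeMajorant]
            field_simp
        · simp [treeMajorant]
    _ ≤ 1 + T1 r := by
        have := (summable_T1 hr hr1).sum_le_tsum (Finset.range n) fun i _ => T1_term_nonneg hr i
        rw [T1]
        linarith

lemma mul_one_sub_eq_one_of_renewal {j r : ℕ → ℝ} (hj : j 0 = 1) (hr : r 0 = 0)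
    (h : ∀ n, n ≠ 0 → j n = ∑ k ∈ Finset.range (n + 1), (n.choose k : ℝ) * (j k * r (n - k))) :
    (PowerSeries.mk fun n => j n / n.factorial) *
      (1 - PowerSeries.mk fun n => r n / n.factorial) = 1 := by
  rw [mul_sub, mul_one, sub_eq_iff_eq_add]
  ext n
  rw [map_add, PowerSeries.coeff_mk, PowerSeries.coeff_mul, PowerSeries.coeff_one,
    Finset.Nat.sum_antidiagonal_eq_sum_range_succ_mk]
  simp only [PowerSeries.coeff_mk]
  rcases eq_or_ne n 0 with rfl | hn
  · simp [hj, hr]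
  · rw [if_neg hn, zero_add, h n hn, Finset.sum_div]
    refine Finset.sum_congr rfl fun k hk => ?_
    have hk : k ≤ n := Nat.lt_succ_iff.1 (Finset.mem_range.1 hk)
    rw [Nat.cast_choose ℝ hk]
    have := Nat.cast_ne_zero (R := ℝ).2 (Nat.factorial_ne_zero n)
    field_simp

lemma vCoef_eq_coeff {d : ℕ} {β : ℝ} {φ : (Fin d → ℝ) → ℝ≥0∞} {H : PowerSeries ℝ}
    (hH : H * (1 + expSeries fun j => bCoef β φ j) = 1) {n : ℕ} (hn : n ≠ 0) :
    vCoef β φ n = n.factorial * PowerSeries.coeff n (H ^ n) := by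
  obtain ⟨m, rfl⟩ := Nat.exists_eq_succ_of_ne_zero hn
  rw [vCoef, if_neg hn, Nat.succ_eq_add_one, ← sum_genBinom_mul_coeff _ hH m (m + 1),
    Finset.sum_range_succ', pow_zero, PowerSeries.coeff_one, if_neg hn, mul_zero, add_zero,
    Finset.mul_sum, Finset.range_eq_Ico, Finset.sum_Ico_add' (fun k => ((m + 1).factorial : ℝ) *
      (genBinom (-((m + 1 : ℕ) : ℝ)) k *
        PowerSeries.coeff (m + 1) ((expSeries fun j => bCoef β φ j) ^ k)))]
  · refine Finset.sum_congr rfl fun k hk => ?_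
    have hk := (Finset.mem_Icc.1 hk).2
    rw [mul_assoc, bellPoly_eq_coeff (by omega)]
    ring
  · simp [expSeries]

lemma abs_vCoef_le {d : ℕ} {β : ℝ} (hβ : 0 < β) {φ : (Fin d → ℝ) → ℝ≥0∞} (hφm : Measurable φ)
    (hφeven : ∀ v, φ (-v) = φ v) (hT : Cbeta β φ < ∞) {n : ℕ} (hn : n ≠ 0) :
    |vCoef β φ n| ≤
      n.factorial * PowerSeries.coeff n (treeMajorant (Cbeta β φ).toReal ^ n) := by
  have hw := isTemperedWeight_pairW hβ hφm hφeven
  obtain ⟨r, hr0, hrnn, hrle, hren⟩ := hw.exists_renewal hT.ne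
  set P : PowerSeries ℝ := PowerSeries.mk fun n => r n / n.factorial with hP
  set J : PowerSeries ℝ :=
    PowerSeries.mk fun n => (hw.rootIntegral n).toReal / n.factorial with hJ
  have hJ0 : (hw.rootIntegral 0).toReal = 1 := by simp [hw.rootIntegral_zero]
  have hJP : J * (1 - P) = 1 := mul_one_sub_eq_one_of_renewal hJ0 hr0 hren
  have hF : 1 + (expSeries fun j => bCoef β φ j) = PowerSeries.rescale (-1) J := by
    ext i
    rw [map_add, PowerSeries.coeff_rescale, expSeries, PowerSeries.coeff_mk,
      PowerSeries.coeff_one, hJ, PowerSeries.coeff_mk]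
    rcases eq_or_ne i 0 with rfl | hi
    · simp [hJ0]
    · rw [if_neg hi, if_neg hi, bCoef_eq hw, zero_add, mul_div_assoc]
  have hH : PowerSeries.rescale (-1) (1 - P) * (1 + expSeries fun j => bCoef β φ j) = 1 := by
    rw [hF, ← map_mul, mul_comm, hJP, map_one]
  rw [vCoef_eq_coeff hH hn, ← map_pow, PowerSeries.coeff_rescale, abs_mul, abs_mul, abs_pow,
    abs_neg, abs_one, one_pow, one_mul, Nat.abs_cast]
  refine mul_le_mul_of_nonneg_left (abs_coeff_pow_le (fun i => ?_) n n) (Nat.cast_nonneg _)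
  rw [map_sub, PowerSeries.coeff_one, hP, PowerSeries.coeff_mk, treeMajorant,
    PowerSeries.coeff_mk]
  rcases i with _ | p
  · simp [hr0]
  · rw [if_neg p.succ_ne_zero, if_neg p.succ_ne_zero, zero_sub, abs_neg,
      abs_of_nonneg (div_nonneg (hrnn _) (Nat.cast_nonneg _)), Nat.add_sub_cancel]
    gcongr
    exact hrle p

lemma abs_vCoef_div_factorial_le {d : ℕ} {β : ℝ} (hβ : 0 < β) {φ : (Fin d → ℝ) → ℝ≥0∞}
    (hφm : Measurable φ) (hφeven : ∀ v, φ (-v) = φ v) (hT : Cbeta β φ < ∞)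
    (hC : 0 < Cbeta β φ) {n : ℕ} (hn : n ≠ 0) {r : ℝ} (hr : 0 < r) (hr1 : r < Real.exp (-1)) :
    |vCoef β φ n| / ((n + 1).factorial : ℝ) ≤
      ((Cbeta β φ).toReal ^ n / ((n : ℝ) + 1)) * ((1 + T1 r) / r) ^ n := by
  set C := (Cbeta β φ).toReal with hCdef
  have hC0 : 0 < C := ENNReal.toReal_pos hC.ne' hT.ne
  have h1 : PowerSeries.coeff n (treeMajorant C ^ n) * (r / C) ^ n ≤ (1 + T1 r) ^ n :=
    (coeff_pow_mul_pow_le (coeff_treeMajorant_nonneg hC0.le) (by positivity) n n).trans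
      (pow_le_pow_left₀ (Finset.sum_nonneg fun i _ =>
        mul_nonneg (coeff_treeMajorant_nonneg hC0.le i) (by positivity))
        (sum_treeMajorant_le hC0 hr.le hr1 n) n)
  have h2 : PowerSeries.coeff n (treeMajorant C ^ n) ≤ C ^ n * ((1 + T1 r) / r) ^ n := by
    rw [← le_div_iff₀ (by positivity)] at h1
    refine h1.trans_eq ?_
    rw [div_pow, div_pow]
    field_simp
  have h3 := abs_vCoef_le hβ hφm hφeven hT hn
  rw [div_le_iff₀ (by positivity), Nat.factorial_succ]
  refine h3.trans ?_
  calc _ ≤ n.factorial * (C ^ n * ((1 + T1 r) / r) ^ n) := by gcongr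
    _ = _ := by push_cast; field_simp

lemma summable_virial_of_lt {d : ℕ} {β : ℝ} (hβ : 0 < β) {φ : (Fin d → ℝ) → ℝ≥0∞}
    (hφm : Measurable φ) (hφeven : ∀ v, φ (-v) = φ v) (hT : Cbeta β φ < ∞)
    (hC : 0 < Cbeta β φ) {r : ℝ} (hr : 0 < r) (hr1 : r < Real.exp (-1)) {z : ℂ}
    (hz : ‖z‖ < 1 / (Cbeta β φ).toReal * (r / (1 + T1 r))) :
    Summable fun n : ℕ => (vCoef β φ n : ℂ) / ((n + 1).factorial : ℂ) * z ^ (n + 1) := by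
  set C := (Cbeta β φ).toReal with hCdef
  have hC0 : 0 < C := ENNReal.toReal_pos hC.ne' hT.ne
  have hT1 : 0 < 1 + T1 r := by linarith [T1_nonneg hr.le]
  set q := C * ((1 + T1 r) / r) * ‖z‖ with hq
  have hq0 : 0 ≤ q := by positivity
  have hq1 : q < 1 := by
    calc q < C * ((1 + T1 r) / r) * (1 / C * (r / (1 + T1 r))) := by
          rw [hq]; gcongr
      _ = 1 := by field_simp
  refine Summable.of_norm_bounded ((summable_geometric_of_lt_one hq0 hq1).mul_right ‖z‖)
    fun n => ?_
  rw [norm_mul, norm_div, norm_pow, Complex.norm_real, Complex.norm_natCast, Real.norm_eq_abs,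
    pow_succ, ← mul_assoc]
  gcongr
  have key : |vCoef β φ n| / ((n + 1).factorial : ℝ) ≤ (C * ((1 + T1 r) / r)) ^ n := by
    rcases eq_or_ne n 0 with rfl | hn
    · simp [vCoef]
    · refine (abs_vCoef_div_factorial_le hβ hφm hφeven hT hC hn hr hr1).trans ?_
      rw [mul_pow]
      gcongr
      exact div_le_self (by positivity) (by linarith [(Nat.cast_nonneg n : (0 : ℝ) ≤ n)])
  rw [hq, mul_pow]
  gcongr

/-- the Groenveld–Ramawadth–Tate bound. -/
theorem statement15 {d : ℕ} (hd : 1 ≤ d) (β : ℝ) (hβ : 0 < β)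
    (φ : (Fin d → ℝ) → ℝ≥0∞) (hφm : Measurable φ) (hφeven : ∀ v, φ (-v) = φ v)
    (hT : Cbeta β φ < ∞) (hC : 0 < Cbeta β φ) :
    (∀ n : ℕ, 1 ≤ n → ∀ r : ℝ, 0 < r → r < Real.exp (-1) →
      |vCoef β φ n| / ((n + 1).factorial : ℝ)
        ≤ ((Cbeta β φ).toReal ^ n / ((n : ℝ) + 1)) * ((1 + T1 r) / r) ^ n) ∧
    ∀ z : ℂ, ENNReal.ofReal ‖z‖ <
        (⨆ (r : ℝ) (_ : 0 < r ∧ r < Real.exp (-1)),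
          ENNReal.ofReal ((1 / (Cbeta β φ).toReal) * (r / (1 + T1 r)))) →
      Summable (fun n : ℕ => (vCoef β φ n : ℂ) / ((n + 1).factorial : ℂ) * z ^ (n + 1)) := by
  refine ⟨fun n hn r hr hr1 =>
    abs_vCoef_div_factorial_le hβ hφm hφeven hT hC (by omega) hr hr1, fun z hz => ?_⟩
  simp only [lt_iSup_iff] at hz
  obtain ⟨r, ⟨hr, hr1⟩, hz⟩ := hz
  exact summable_virial_of_lt hβ hφm hφeven hT hC hr hr1
    ((ENNReal.ofReal_lt_ofReal_iff_of_nonneg (norm_nonneg z)).1 hz)
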